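/- arXiv:0909.0319 — 5 statements merged into one kernel-verified Lean document; each statement's English description precedes it below -/
import Mathlib

section
/- Let E be a regular Courant algebroid with anchor ρ. Then (ker ρ)⊥ ⊆ ker ρ, and: (i) the formula [π(r),π(s)]_𝒢 := π(r∘s), for r,s ∈ Γ(ker ρ), is a well-defined C^∞(M)-bilinear skew-symmetric operation making 𝒢 := ker ρ/(ker ρ)⊥ a bundle of Lie algebras; (ii) the formula ⟨π(r),π(s)⟩_𝒢 := ⟨r,s⟩ is a well-defined fiberwise nondegenerate symmetric ad-invariant pairing on 𝒢; (iii) the formula x·π(r) := q(e)∘-induced bracket [x, q(r)] on 𝒜_E := E/(ker ρ)⊥, for x ∈ Γ(𝒜_E) and r ∈ Γ(ker ρ), is a well-defined representation of the Lie algebroid 𝒜_E on 𝒢 satisfying a(x)⟨r,s⟩_𝒢 = ⟨x·r,s⟩_𝒢 + ⟨r,x·s⟩_𝒢 for all x ∈ Γ(𝒜_E), r,s ∈ Γ(𝒢). Consequently the ample Lie algebroid 𝒜_E is a quadratic Lie algebroid. -/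
/-! # Statement 0
For a regular Courant algebroid `E` with anchor `ρ`: `(ker ρ)⊥ ⊆ ker ρ`, the quotient
`𝒢 := ker ρ/(ker ρ)⊥` is a bundle of quadratic Lie algebras, and `𝒜_E := E/(ker ρ)⊥`
acts on `𝒢` compatibly with the pairing; hence `𝒜_E` is a quadratic Lie algebroid.

Algebraic model: `A` plays the role of `C^∞(M)`, vector fields are `Derivation ℝ A A`,
and `E` is the `A`-module of sections. -/

/-- A Courant algebroid (in algebraic form). -/
structure CourantAlgebroid (A : Type) [CommRing A] [Algebra ℝ A]
    (E : Type) [AddCommGroup E] [Module A E] [Module ℝ E] [IsScalarTower ℝ A E] where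
  /-- the pseudo-metric `⟨-,-⟩` -/
  ip : E →ₗ[A] E →ₗ[A] A
  /-- the anchor `ρ` -/
  rho : E →ₗ[A] Derivation ℝ A A
  /-- the Dorfman bracket `∘` (ℝ-bilinear) -/
  dorf : E →ₗ[ℝ] E →ₗ[ℝ] E
  /-- the map `𝒟 : C^∞(M) → Γ(E)` -/
  Dmap : A → E
  ip_symm : ∀ e₁ e₂, ip e₁ e₂ = ip e₂ e₁
  /-- fiberwise nondegeneracy of the pseudo-metric: `Ξ : E → E*` is bijective -/
  ip_nondeg : Function.Bijective fun e => ip e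
  /-- `⟨𝒟f, e⟩ = ½ ρ(e) f` -/
  ip_D : ∀ (f : A) (e : E), (2 : A) * ip (Dmap f) e = rho e f
  /-- `ρ ∘ 𝒟 = 0` -/
  rho_D : ∀ f : A, rho (Dmap f) = 0
  dorf_jacobi : ∀ e₁ e₂ e₃,
    dorf e₁ (dorf e₂ e₃) = dorf (dorf e₁ e₂) e₃ + dorf e₂ (dorf e₁ e₃)
  rho_dorf : ∀ e₁ e₂, rho (dorf e₁ e₂) = ⁅rho e₁, rho e₂⁆
  dorf_leibniz : ∀ (e₁ : E) (f : A) (e₂ : E),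
    dorf e₁ (f • e₂) = rho e₁ f • e₂ + f • dorf e₁ e₂
  dorf_sym : ∀ e₁ e₂, dorf e₁ e₂ + dorf e₂ e₁ = (2 : ℝ) • Dmap (ip e₁ e₂)
  dorf_D : ∀ (f : A) (e : E), dorf (Dmap f) e = 0
  rho_ip : ∀ e₁ e₂ e₃,
    rho e₁ (ip e₂ e₃) = ip (dorf e₁ e₂) e₃ + ip e₂ (dorf e₁ e₃)

namespace CourantAlgebroid

variable {A : Type} [CommRing A] [Algebra ℝ A]
variable {E : Type} [AddCommGroup E] [Module A E] [Module ℝ E] [IsScalarTower ℝ A E]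
variable (ca : CourantAlgebroid A E)

/-- `(ker ρ)⊥`, the subbundle of `E` orthogonal to `ker ρ` w.r.t. the pseudo-metric. -/
def perp : Submodule A E where
  carrier := {e | ∀ k ∈ LinearMap.ker ca.rho, ca.ip e k = 0}
  add_mem' := by
    intro a b ha hb k hk
    simp [map_add, ha k hk, hb k hk]
  zero_mem' := by intro k hk; simp
  smul_mem' := by
    intro c x hx k hk
    simp [map_smul, hx k hk]

/-- Regularity (constant rank of the anchor), expressed by the splitting of the two
canonical short exact sequences `0 → ker ρ → E → F → 0` and
`0 → (ker ρ)⊥ → ker ρ → 𝒢 → 0`. -/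
def IsRegular : Prop :=
  (∃ lam : ↥(LinearMap.range ca.rho) →ₗ[A] E, ∀ x, ca.rho (lam x) = ↑x) ∧
  (∃ sig : (↥(LinearMap.ker ca.rho) ⧸
        (ca.perp.comap (LinearMap.ker ca.rho).subtype)) →ₗ[A] ↥(LinearMap.ker ca.rho),
      ∀ g, (ca.perp.comap (LinearMap.ker ca.rho).subtype).mkQ (sig g) = g)

lemma dorf_mem_ker {r s : E} (hr : r ∈ LinearMap.ker ca.rho)
    (hs : s ∈ LinearMap.ker ca.rho) : ca.dorf r s ∈ LinearMap.ker ca.rho := by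
  rw [LinearMap.mem_ker] at *
  rw [ca.rho_dorf, hr, hs, zero_lie]

lemma dorf_ker_left_mem_ker (e : E) {r : E} (hr : r ∈ LinearMap.ker ca.rho) :
    ca.dorf e r ∈ LinearMap.ker ca.rho := by
  rw [LinearMap.mem_ker] at *
  rw [ca.rho_dorf, hr, lie_zero]

/-- sections of `ker ρ` -/
abbrev Ker := ↥(LinearMap.ker ca.rho)

/-- `(ker ρ)⊥` viewed inside `ker ρ` -/
abbrev perp' : Submodule A ca.Ker := ca.perp.comap (LinearMap.ker ca.rho).subtype

/-- `𝒢 := ker ρ/(ker ρ)⊥` -/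
abbrev Gq := ca.Ker ⧸ ca.perp'

/-- the projection `π : ker ρ → 𝒢` -/
abbrev piG : ca.Ker →ₗ[A] ca.Gq := ca.perp'.mkQ

/-- the ample quotient `𝒜_E := E/(ker ρ)⊥` -/
abbrev Ample := E ⧸ ca.perp

/-- the projection `q : E → 𝒜_E` -/
abbrev qA : E →ₗ[A] ca.Ample := ca.perp.mkQ

/-- Dorfman bracket of two sections of `ker ρ`, viewed in `ker ρ`. -/
def dorfK (r s : ca.Ker) : ca.Ker := ⟨ca.dorf ↑r ↑s, ca.dorf_mem_ker r.2 s.2⟩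

/-- Dorfman bracket of a section of `E` with a section of `ker ρ`, viewed in `ker ρ`. -/
def dorfEK (e : E) (r : ca.Ker) : ca.Ker := ⟨ca.dorf e ↑r, ca.dorf_ker_left_mem_ker e r.2⟩

end CourantAlgebroid

namespace CourantAlgebroid

variable {A : Type} [CommRing A] [Algebra ℝ A]
variable {E : Type} [AddCommGroup E] [Module A E] [Module ℝ E] [IsScalarTower ℝ A E]
variable (ca : CourantAlgebroid A E)

lemma eq_zero_of_two_mul {a : A} (h : (2 : A) * a = 0) : a = 0 := by
  have h2 : (2 : ℝ) • a = 0 := by rw [Algebra.smul_def, map_ofNat, h]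
  simpa using congrArg ((2 : ℝ)⁻¹ • ·) h2

lemma Dmap_mem_perp (f : A) : ca.Dmap f ∈ ca.perp := fun k hk =>
  eq_zero_of_two_mul (by rw [ca.ip_D, LinearMap.mem_ker.1 hk, Derivation.zero_apply])

lemma perp_le_ker : ca.perp ≤ LinearMap.ker ca.rho := fun e he => by
  ext f
  rw [← ca.ip_D, ca.ip_symm, he _ (ca.rho_D f), mul_zero, Derivation.zero_apply]

lemma dorf_add_swap_mem_perp (e e' : E) : ca.dorf e e' + ca.dorf e' e ∈ ca.perp := by
  rw [ca.dorf_sym, two_smul]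
  exact add_mem (ca.Dmap_mem_perp _) (ca.Dmap_mem_perp _)

lemma dorf_mem_perp (e : E) {p : E} (hp : p ∈ ca.perp) : ca.dorf e p ∈ ca.perp := fun k hk => by
  have h := ca.rho_ip e p k
  rwa [hp k hk, map_zero, hp _ (ca.dorf_ker_left_mem_ker e hk), add_zero, eq_comm] at h

lemma dorf_mem_perp_left {p : E} (hp : p ∈ ca.perp) (e : E) : ca.dorf p e ∈ ca.perp :=
  (Submodule.add_mem_iff_left _ (ca.dorf_mem_perp e hp)).1 (ca.dorf_add_swap_mem_perp p e)

lemma dorf_sub_dorf_mem_perp {e₁ e₂ e₁' e₂' : E} (h : e₁ - e₂ ∈ ca.perp)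
    (h' : e₁' - e₂' ∈ ca.perp) : ca.dorf e₁ e₁' - ca.dorf e₂ e₂' ∈ ca.perp := by
  have := add_mem (ca.dorf_mem_perp_left h e₁') (ca.dorf_mem_perp e₂ h')
  simpa only [map_sub, LinearMap.sub_apply, sub_add_sub_cancel] using this

/-- For `r` in `ker ρ`, the Dorfman bracket `e ∘ r` is `A`-linear in `e` modulo `(ker ρ)⊥`. -/
lemma dorf_smul_left_sub_mem_perp (f : A) (e : E) {r : E} (hr : r ∈ LinearMap.ker ca.rho) :
    ca.dorf (f • e) r - f • ca.dorf e r ∈ ca.perp := by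
  have h := sub_mem (ca.dorf_add_swap_mem_perp (f • e) r)
    (ca.perp.smul_mem f (ca.dorf_add_swap_mem_perp e r))
  rw [ca.dorf_leibniz, LinearMap.mem_ker.1 hr, Derivation.zero_apply, zero_smul, zero_add,
    smul_add, add_sub_add_right_eq_sub] at h
  exact h

/-- The anchor of the ample Lie algebroid. -/
def ampleAnchor : ca.Ample →ₗ[A] Derivation ℝ A A := ca.perp.liftQ ca.rho ca.perp_le_ker

/-- The bracket of the ample Lie algebroid. -/
def ampleBracket : ca.Ample → ca.Ample → ca.Ample :=
  Quotient.map₂ (fun e e' => ca.dorf e e') fun _ _ h _ _ h' =>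
    (Submodule.quotientRel_def _).2 (ca.dorf_sub_dorf_mem_perp
      ((Submodule.quotientRel_def _).1 h) ((Submodule.quotientRel_def _).1 h'))

/-- The action of the ample Lie algebroid on `𝒢`. -/
def ampleAct : ca.Ample → ca.Gq → ca.Gq :=
  Quotient.map₂ (fun e r => ca.dorfEK e r) fun _ _ h _ _ h' =>
    (Submodule.quotientRel_def _).2 (ca.dorf_sub_dorf_mem_perp
      ((Submodule.quotientRel_def _).1 h) ((Submodule.quotientRel_def ca.perp').1 h'))

lemma ampleAnchor_qA (e : E) : ca.ampleAnchor (ca.qA e) = ca.rho e := rfl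

lemma ampleBracket_qA (e e' : E) :
    ca.ampleBracket (ca.qA e) (ca.qA e') = ca.qA (ca.dorf e e') := rfl

lemma ampleAct_qA_piG (e : E) (r : ca.Ker) :
    ca.ampleAct (ca.qA e) (ca.piG r) = ca.piG (ca.dorfEK e r) := rfl

lemma qA_surjective : Function.Surjective ca.qA := ca.perp.mkQ_surjective

lemma piG_surjective : Function.Surjective ca.piG := ca.perp'.mkQ_surjective

lemma qA_eq_qA {e e' : E} : ca.qA e = ca.qA e' ↔ e - e' ∈ ca.perp :=
  Submodule.Quotient.eq _

lemma piG_eq_piG {r s : ca.Ker} : ca.piG r = ca.piG s ↔ (r : E) - s ∈ ca.perp :=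
  Submodule.Quotient.eq _

lemma ampleBracket_swap (u v : ca.Ample) : ca.ampleBracket u v = -ca.ampleBracket v u := by
  obtain ⟨e, rfl⟩ := ca.qA_surjective u
  obtain ⟨e', rfl⟩ := ca.qA_surjective v
  rw [ampleBracket_qA, ampleBracket_qA, ← map_neg, qA_eq_qA, sub_neg_eq_add]
  exact ca.dorf_add_swap_mem_perp e e'

lemma ampleBracket_jacobi (u v w : ca.Ample) :
    ca.ampleBracket u (ca.ampleBracket v w) =
      ca.ampleBracket (ca.ampleBracket u v) w + ca.ampleBracket v (ca.ampleBracket u w) := by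
  obtain ⟨e, rfl⟩ := ca.qA_surjective u
  obtain ⟨e', rfl⟩ := ca.qA_surjective v
  obtain ⟨e'', rfl⟩ := ca.qA_surjective w
  simp only [ampleBracket_qA, ← map_add, ← ca.dorf_jacobi]

lemma ampleBracket_smul (u : ca.Ample) (f : A) (v : ca.Ample) :
    ca.ampleBracket u (f • v) = f • ca.ampleBracket u v + ca.ampleAnchor u f • v := by
  obtain ⟨e, rfl⟩ := ca.qA_surjective u
  obtain ⟨e', rfl⟩ := ca.qA_surjective v
  simp only [ampleBracket_qA, ampleAnchor_qA, ← map_smul, ← map_add, ca.dorf_leibniz, add_comm]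

lemma ampleAnchor_ampleBracket (u v : ca.Ample) :
    ca.ampleAnchor (ca.ampleBracket u v) = ⁅ca.ampleAnchor u, ca.ampleAnchor v⁆ := by
  obtain ⟨e, rfl⟩ := ca.qA_surjective u
  obtain ⟨e', rfl⟩ := ca.qA_surjective v
  exact ca.rho_dorf e e'

lemma ampleAct_add_left (x x' : ca.Ample) (g : ca.Gq) :
    ca.ampleAct (x + x') g = ca.ampleAct x g + ca.ampleAct x' g := by
  obtain ⟨e, rfl⟩ := ca.qA_surjective x
  obtain ⟨e', rfl⟩ := ca.qA_surjective x'
  obtain ⟨r, rfl⟩ := ca.piG_surjective g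
  simp only [ampleAct_qA_piG, ← map_add]
  congr 1
  ext
  simp [dorfEK]

lemma ampleAct_smul_left (f : A) (x : ca.Ample) (g : ca.Gq) :
    ca.ampleAct (f • x) g = f • ca.ampleAct x g := by
  obtain ⟨e, rfl⟩ := ca.qA_surjective x
  obtain ⟨r, rfl⟩ := ca.piG_surjective g
  simp only [ampleAct_qA_piG, ← map_smul]
  exact ca.piG_eq_piG.2 (ca.dorf_smul_left_sub_mem_perp f e r.2)

lemma ampleAct_add_right (x : ca.Ample) (g h : ca.Gq) :
    ca.ampleAct x (g + h) = ca.ampleAct x g + ca.ampleAct x h := by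
  obtain ⟨e, rfl⟩ := ca.qA_surjective x
  obtain ⟨r, rfl⟩ := ca.piG_surjective g
  obtain ⟨s, rfl⟩ := ca.piG_surjective h
  simp only [ampleAct_qA_piG, ← map_add]
  congr 1
  ext
  simp [dorfEK]

lemma ampleAct_smul_right (x : ca.Ample) (f : A) (g : ca.Gq) :
    ca.ampleAct x (f • g) = f • ca.ampleAct x g + ca.ampleAnchor x f • g := by
  obtain ⟨e, rfl⟩ := ca.qA_surjective x
  obtain ⟨r, rfl⟩ := ca.piG_surjective g
  simp only [ampleAct_qA_piG, ampleAnchor_qA, ← map_smul, ← map_add]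
  congr 1
  ext
  simp [dorfEK, ca.dorf_leibniz, add_comm]

lemma ampleAct_ampleBracket (x y : ca.Ample) (g : ca.Gq) :
    ca.ampleAct (ca.ampleBracket x y) g =
      ca.ampleAct x (ca.ampleAct y g) - ca.ampleAct y (ca.ampleAct x g) := by
  obtain ⟨e, rfl⟩ := ca.qA_surjective x
  obtain ⟨e', rfl⟩ := ca.qA_surjective y
  obtain ⟨r, rfl⟩ := ca.piG_surjective g
  simp only [ampleBracket_qA, ampleAct_qA_piG, ← map_sub]
  congr 1
  ext
  simp [dorfEK, ca.dorf_jacobi e e']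

/-- The inclusion of `𝒢` into the ample Lie algebroid. -/
def inclG : ca.Gq →ₗ[A] ca.Ample := ca.perp'.mapQ ca.perp (LinearMap.ker ca.rho).subtype le_rfl

lemma inclG_piG (r : ca.Ker) : ca.inclG (ca.piG r) = ca.qA r := rfl

lemma ampleAnchor_inclG (g : ca.Gq) : ca.ampleAnchor (ca.inclG g) = 0 := by
  obtain ⟨r, rfl⟩ := ca.piG_surjective g
  exact r.2

lemma inclG_ampleAct (x : ca.Ample) (g : ca.Gq) :
    ca.inclG (ca.ampleAct x g) = ca.ampleBracket x (ca.inclG g) := by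
  obtain ⟨e, rfl⟩ := ca.qA_surjective x
  obtain ⟨r, rfl⟩ := ca.piG_surjective g
  rfl

/-- The Lie bracket on `𝒢`. -/
def bracketG : ca.Gq →ₗ[A] ca.Gq →ₗ[A] ca.Gq :=
  LinearMap.mk₂ A (fun g h => ca.ampleAct (ca.inclG g) h)
    (fun g g' h => by rw [map_add, ampleAct_add_left])
    (fun f g h => by rw [map_smul, ampleAct_smul_left])
    (fun g h h' => ca.ampleAct_add_right _ h h')
    (fun f g h => by
      rw [ampleAct_smul_right, ampleAnchor_inclG, Derivation.zero_apply, zero_smul, add_zero])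

lemma bracketG_apply (g h : ca.Gq) : ca.bracketG g h = ca.ampleAct (ca.inclG g) h := rfl

lemma bracketG_piG (r s : ca.Ker) :
    ca.bracketG (ca.piG r) (ca.piG s) = ca.piG (ca.dorfK r s) := rfl

lemma bracketG_swap (g h : ca.Gq) : ca.bracketG g h = -ca.bracketG h g := by
  obtain ⟨r, rfl⟩ := ca.piG_surjective g
  obtain ⟨s, rfl⟩ := ca.piG_surjective h
  rw [bracketG_piG, bracketG_piG, ← map_neg, piG_eq_piG, Submodule.coe_neg, sub_neg_eq_add]
  exact ca.dorf_add_swap_mem_perp r s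

lemma bracketG_jacobi (g h k : ca.Gq) :
    ca.bracketG g (ca.bracketG h k) =
      ca.bracketG (ca.bracketG g h) k + ca.bracketG h (ca.bracketG g k) := by
  simp only [bracketG_apply, inclG_ampleAct, ampleAct_ampleBracket, sub_add_cancel]

/-- The pairing on `𝒢`. -/
def ipG : ca.Gq →ₗ[A] ca.Gq →ₗ[A] A :=
  ca.perp'.liftQ
    (LinearMap.flip (ca.perp'.liftQ (ca.ip.domRestrict₁₂ _ _)
      fun r hr => by ext s; exact hr s s.2))
    fun r hr => by
      ext s
      exact (ca.ip_symm s r).trans (hr s s.2)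

lemma ipG_piG (r s : ca.Ker) : ca.ipG (ca.piG r) (ca.piG s) = ca.ip r s := ca.ip_symm s r

lemma ipG_symm (g h : ca.Gq) : ca.ipG g h = ca.ipG h g := by
  obtain ⟨r, rfl⟩ := ca.piG_surjective g
  obtain ⟨s, rfl⟩ := ca.piG_surjective h
  rw [ipG_piG, ipG_piG, ca.ip_symm]

lemma ipG_nondegenerate (g : ca.Gq) (hg : ∀ h, ca.ipG g h = 0) : g = 0 := by
  obtain ⟨r, rfl⟩ := ca.piG_surjective g
  exact (Submodule.Quotient.mk_eq_zero _).2 fun k hk =>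
    (ca.ipG_piG r ⟨k, hk⟩).symm.trans (hg _)

lemma ampleAnchor_ipG (x : ca.Ample) (g h : ca.Gq) :
    ca.ampleAnchor x (ca.ipG g h) =
      ca.ipG (ca.ampleAct x g) h + ca.ipG g (ca.ampleAct x h) := by
  obtain ⟨e, rfl⟩ := ca.qA_surjective x
  obtain ⟨r, rfl⟩ := ca.piG_surjective g
  obtain ⟨s, rfl⟩ := ca.piG_surjective h
  simp only [ampleAct_qA_piG, ipG_piG]
  exact ca.rho_ip e r s

lemma ipG_bracketG (g h k : ca.Gq) :
    ca.ipG (ca.bracketG g h) k + ca.ipG h (ca.bracketG g k) = 0 := by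
  rw [bracketG_apply, bracketG_apply, ← ampleAnchor_ipG, ampleAnchor_inclG,
    Derivation.zero_apply]

lemma linearMap_ext_piG {N : Type*} [AddCommGroup N] [Module A N]
    {φ ψ : ca.Gq →ₗ[A] ca.Gq →ₗ[A] N}
    (h : ∀ r s : ca.Ker, φ (ca.piG r) (ca.piG s) = ψ (ca.piG r) (ca.piG s)) : φ = ψ := by
  ext r s
  exact h r s

end CourantAlgebroid

open CourantAlgebroid in
/-- For a regular Courant algebroid: `(ker ρ)⊥ ⊆ ker ρ`; (i) the Dorfman
bracket descends to a well-defined `C^∞(M)`-bilinear skew-symmetric bracket making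
`𝒢 = ker ρ/(ker ρ)⊥` a bundle of Lie algebras; (ii) the pseudo-metric descends to a
well-defined nondegenerate symmetric ad-invariant pairing on `𝒢`; (iii) the Dorfman
bracket induces a well-defined representation of the ample Lie algebroid
`𝒜_E = E/(ker ρ)⊥` on `𝒢` compatible with the pairing; consequently `𝒜_E` is a
quadratic Lie algebroid. -/
theorem statement0
    {A : Type} [CommRing A] [Algebra ℝ A]
    {E : Type} [AddCommGroup E] [Module A E] [Module ℝ E] [IsScalarTower ℝ A E]
    (ca : CourantAlgebroid A E) (hreg : ca.IsRegular) :
    ca.perp ≤ LinearMap.ker ca.rho ∧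
    ∃ (lG : ca.Gq →ₗ[A] ca.Gq →ₗ[A] ca.Gq) (ipG : ca.Gq →ₗ[A] ca.Gq →ₗ[A] A)
      (aA : ca.Ample →ₗ[A] Derivation ℝ A A) (lA : ca.Ample → ca.Ample → ca.Ample)
      (act : ca.Ample → ca.Gq → ca.Gq),
      -- (i) the bracket on 𝒢 is well defined (and `A`-bilinear, being a `lG`)
      (∀ r s : ca.Ker, lG (ca.piG r) (ca.piG s) = ca.piG (ca.dorfK r s)) ∧
      (∀ lG' : ca.Gq →ₗ[A] ca.Gq →ₗ[A] ca.Gq,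
        (∀ r s : ca.Ker, lG' (ca.piG r) (ca.piG s) = ca.piG (ca.dorfK r s)) → lG' = lG) ∧
      (∀ g h, lG g h = - lG h g) ∧
      (∀ g h k, lG g (lG h k) = lG (lG g h) k + lG h (lG g k)) ∧
      -- (ii) the pairing on 𝒢 is well defined, symmetric, nondegenerate, ad-invariant
      (∀ r s : ca.Ker, ipG (ca.piG r) (ca.piG s) = ca.ip ↑r ↑s) ∧
      (∀ ipG' : ca.Gq →ₗ[A] ca.Gq →ₗ[A] A,
        (∀ r s : ca.Ker, ipG' (ca.piG r) (ca.piG s) = ca.ip ↑r ↑s) → ipG' = ipG) ∧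
      (∀ g h, ipG g h = ipG h g) ∧
      (∀ g, (∀ h, ipG g h = 0) → g = 0) ∧
      (∀ g h k, ipG (lG g h) k + ipG h (lG g k) = 0) ∧
      -- the ample Lie algebroid structure on 𝒜_E
      (∀ e : E, aA (ca.qA e) = ca.rho e) ∧
      (∀ e e' : E, lA (ca.qA e) (ca.qA e') = ca.qA (ca.dorf e e')) ∧
      (∀ u v, lA u v = - lA v u) ∧
      (∀ u v w, lA u (lA v w) = lA (lA u v) w + lA v (lA u w)) ∧
      (∀ u (f : A) v, lA u (f • v) = f • lA u v + aA u f • v) ∧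
      (∀ u v, aA (lA u v) = ⁅aA u, aA v⁆) ∧
      -- (iii) the representation of 𝒜_E on 𝒢 is well defined ...
      (∀ (e : E) (r : ca.Ker), act (ca.qA e) (ca.piG r) = ca.piG (ca.dorfEK e r)) ∧
      (∀ act' : ca.Ample → ca.Gq → ca.Gq,
        (∀ (e : E) (r : ca.Ker), act' (ca.qA e) (ca.piG r) = ca.piG (ca.dorfEK e r)) →
          act' = act) ∧
      -- ... and is a representation of the Lie algebroid 𝒜_E on 𝒢
      (∀ x x' g, act (x + x') g = act x g + act x' g) ∧
      (∀ (f : A) x g, act (f • x) g = f • act x g) ∧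
      (∀ x g h, act x (g + h) = act x g + act x h) ∧
      (∀ x (f : A) g, act x (f • g) = f • act x g + aA x f • g) ∧
      (∀ x y g, act (lA x y) g = act x (act y g) - act y (act x g)) ∧
      -- ... compatible with the pseudo-metric: `a(x)⟨r,s⟩ = ⟨x·r,s⟩ + ⟨r,x·s⟩`
      (∀ x g h, aA x (ipG g h) = ipG (act x g) h + ipG g (act x h)) := by
  refine ⟨ca.perp_le_ker, ca.bracketG, ca.ipG, ca.ampleAnchor, ca.ampleBracket, ca.ampleAct,
    ca.bracketG_piG, fun _ h => ca.linearMap_ext_piG h, ca.bracketG_swap, ca.bracketG_jacobi,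
    ca.ipG_piG, fun _ h => ca.linearMap_ext_piG fun r s => (h r s).trans (ca.ipG_piG r s).symm,
    ca.ipG_symm, ca.ipG_nondegenerate, ca.ipG_bracketG,
    ca.ampleAnchor_qA, ca.ampleBracket_qA, ca.ampleBracket_swap, ca.ampleBracket_jacobi,
    ca.ampleBracket_smul, ca.ampleAnchor_ampleBracket,
    ca.ampleAct_qA_piG, fun act' h => ?_, ca.ampleAct_add_left, ca.ampleAct_smul_left,
    ca.ampleAct_add_right, ca.ampleAct_smul_right, ca.ampleAct_ampleBracket,
    ca.ampleAnchor_ipG⟩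
  funext x g
  obtain ⟨e, rfl⟩ := ca.qA_surjective x
  obtain ⟨r, rfl⟩ := ca.piG_surjective g
  exact h e r
end

section
/- Let (E,⟨-,-⟩,∘,ρ) be a regular Courant algebroid and F = ρ(E). Then: (a) there exists a splitting λ : F → E of the short exact sequence 0 → ker ρ → E → F → 0 whose image λ(F) is isotropic in E; (b) given such a λ, there exists a unique splitting σ_λ : 𝒢 → ker ρ of the short exact sequence 0 → (ker ρ)⊥ → ker ρ → 𝒢 → 0 with image σ_λ(𝒢) orthogonal to λ(F); (c) given such λ and σ_λ, the map Ψ_λ : F*⊕𝒢⊕F → E, Ψ_λ(ξ+r+x) = ½Ξ⁻¹ρ*(ξ) + σ_λ(r) + λ(x), is a dissection of E. In particular every regular Courant algebroid admits a dissection. -/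
namespace CourantAlgebroid

variable {A : Type} [CommRing A] [Algebra ℝ A]
variable {E : Type} [AddCommGroup E] [Module A E] [Module ℝ E] [IsScalarTower ℝ A E]
variable (ca : CourantAlgebroid A E)

/-- The isomorphism `Ξ : E → E*` induced by the pseudo-metric. -/
noncomputable def flat : E ≃ₗ[A] Module.Dual A E :=
  LinearEquiv.ofBijective ca.ip ca.ip_nondeg

/-- The map `Ξ⁻¹ ∘ ρ* : F* → E`. -/
noncomputable def coanchor : Module.Dual A ↥(LinearMap.range ca.rho) →ₗ[A] E :=
  ca.flat.symm.toLinearMap ∘ₗ ca.rho.rangeRestrict.dualMap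

lemma ip_coanchor (ξ : Module.Dual A ↥(LinearMap.range ca.rho)) :
    ca.ip (ca.coanchor ξ) = ξ.comp ca.rho.rangeRestrict :=
  ca.flat.apply_symm_apply (ξ.comp ca.rho.rangeRestrict)

lemma ip_coanchor_apply (ξ : Module.Dual A ↥(LinearMap.range ca.rho)) (e : E) :
    ca.ip (ca.coanchor ξ) e = ξ (ca.rho.rangeRestrict e) := by
  rw [ip_coanchor, LinearMap.comp_apply]

lemma invFun_ip_eq_coanchor (ξ : Module.Dual A ↥(LinearMap.range ca.rho)) :
    Function.invFun (fun e => ca.ip e) (ξ.comp ca.rho.rangeRestrict) = ca.coanchor ξ := by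
  rw [← ca.ip_coanchor]
  exact Function.leftInverse_invFun ca.ip_nondeg.1 (ca.coanchor ξ)

lemma rangeRestrict_eq_zero {e : E} (he : ca.rho e = 0) : ca.rho.rangeRestrict e = 0 :=
  Subtype.ext he

lemma coanchor_mem_perp (ξ : Module.Dual A ↥(LinearMap.range ca.rho)) :
    ca.coanchor ξ ∈ ca.perp := fun k hk => by
  rw [ip_coanchor_apply, ca.rangeRestrict_eq_zero hk, map_zero]

@[simp]
lemma rho_coanchor (ξ : Module.Dual A ↥(LinearMap.range ca.rho)) :
    ca.rho (ca.coanchor ξ) = 0 :=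
  ca.perp_le_ker (ca.coanchor_mem_perp ξ)

lemma eq_zero_of_ip_eq_zero {e : E} (h : ∀ e', ca.ip e e' = 0) : e = 0 :=
  ca.ip_nondeg.1 (LinearMap.ext fun e' => by simp [h e'])

section Splitting

variable {ca} {lam : ↥(LinearMap.range ca.rho) →ₗ[A] E}

lemma rangeRestrict_splitting (hlam : ∀ x, ca.rho (lam x) = ↑x)
    (x : ↥(LinearMap.range ca.rho)) : ca.rho.rangeRestrict (lam x) = x :=
  Subtype.ext (hlam x)

lemma ip_coanchor_splitting (hlam : ∀ x, ca.rho (lam x) = ↑x)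
    (ξ : Module.Dual A ↥(LinearMap.range ca.rho)) (x : ↥(LinearMap.range ca.rho)) :
    ca.ip (ca.coanchor ξ) (lam x) = ξ x := by
  rw [ip_coanchor_apply, rangeRestrict_splitting hlam]

lemma sub_splitting_mem_ker (hlam : ∀ x, ca.rho (lam x) = ↑x) (e : E) :
    e - lam (ca.rho.rangeRestrict e) ∈ LinearMap.ker ca.rho := by
  simp [hlam]

lemma eq_zero_of_mem_perp (hlam : ∀ x, ca.rho (lam x) = ↑x) {e : E} (he : e ∈ ca.perp)
    (h : ∀ x, ca.ip e (lam x) = 0) : e = 0 := by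
  refine ca.eq_zero_of_ip_eq_zero fun e' => ?_
  have := he _ (sub_splitting_mem_ker hlam e')
  rwa [map_sub, h, sub_zero] at this

lemma coanchor_ip_splitting (hlam : ∀ x, ca.rho (lam x) = ↑x) {e : E} (he : e ∈ ca.perp) :
    ca.coanchor ((ca.ip e).comp lam) = e := by
  refine sub_eq_zero.1 (eq_zero_of_mem_perp hlam
    (sub_mem (ca.coanchor_mem_perp _) he) fun x => ?_)
  simp [ip_coanchor_splitting hlam]

lemma ip_perp_ker {e k : E} (he : e ∈ ca.perp) (hk : ca.rho k = 0) : ca.ip e k = 0 :=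
  he k hk

/-- Any splitting of the anchor can be corrected to an isotropic one. -/
lemma exists_isotropic_splitting (hlam : ∀ x, ca.rho (lam x) = ↑x) :
    ∃ lam' : ↥(LinearMap.range ca.rho) →ₗ[A] E,
      (∀ x, ca.rho (lam' x) = ↑x) ∧ ∀ x y, ca.ip (lam' x) (lam' y) = 0 := by
  let c : A := algebraMap ℝ A 2⁻¹
  have hc : c + c = 1 := by
    rw [← map_add, ← map_one (algebraMap ℝ A)]
    norm_num
  let φ := (ca.ip.comp lam).compl₂ lam
  refine ⟨lam - c • ca.coanchor.comp φ, fun x => by simp [hlam], fun x y => ?_⟩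
  have h1 : ca.ip (ca.coanchor (φ x)) (lam y) = ca.ip (lam x) (lam y) :=
    ip_coanchor_splitting hlam _ _
  have h2 : ca.ip (lam x) (ca.coanchor (φ y)) = ca.ip (lam x) (lam y) := by
    rw [ca.ip_symm, ca.ip_symm (lam x)]
    exact ip_coanchor_splitting hlam _ _
  have h3 : ca.ip (ca.coanchor (φ x)) (ca.coanchor (φ y)) = 0 :=
    ip_perp_ker (ca.coanchor_mem_perp _) (ca.rho_coanchor _)
  simp only [LinearMap.sub_apply, LinearMap.smul_apply, LinearMap.comp_apply, map_sub, map_smul,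
    smul_eq_mul, h1, h2, h3]
  linear_combination -ca.ip (lam x) (lam y) * hc

/-- The difference of two elements of `ker ρ` with the same class in `𝒢` lies in `(ker ρ)⊥`. -/
lemma sub_mem_perp {r s : ca.Ker} (h : ca.piG r = ca.piG s) : (r : E) - s ∈ ca.perp :=
  (Submodule.Quotient.eq ca.perp').1 h

lemma ip_eq_ip_of_piG_eq {r r' s s' : ca.Ker} (hr : ca.piG r = ca.piG r')
    (hs : ca.piG s = ca.piG s') : ca.ip (r : E) s = ca.ip (r' : E) s' := by
  have h1 := ip_perp_ker (sub_mem_perp hr) s.2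
  have h2 := ip_perp_ker (sub_mem_perp hs) r'.2
  rw [ca.ip_symm] at h2
  simp only [map_sub, LinearMap.sub_apply] at h1 h2
  linear_combination h1 + h2

lemma orthogonal_splitting_unique (hlam : ∀ x, ca.rho (lam x) = ↑x)
    {sig sig' : ca.Gq →ₗ[A] ca.Ker} (hsig : ∀ g, ca.piG (sig g) = g)
    (horth : ∀ g x, ca.ip ↑(sig g) (lam x) = 0) (hsig' : ∀ g, ca.piG (sig' g) = g)
    (horth' : ∀ g x, ca.ip ↑(sig' g) (lam x) = 0) : sig = sig' := by
  refine LinearMap.ext fun g => Subtype.ext (sub_eq_zero.1 (eq_zero_of_mem_perp hlam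
    (sub_mem_perp ((hsig g).trans (hsig' g).symm)) fun x => ?_))
  rw [map_sub, LinearMap.sub_apply, horth, horth', sub_zero]

lemma existsUnique_orthogonal_splitting (hlam : ∀ x, ca.rho (lam x) = ↑x)
    {sig : ca.Gq →ₗ[A] ca.Ker} (hsig : ∀ g, ca.piG (sig g) = g) :
    ∃! sig' : ca.Gq →ₗ[A] ca.Ker,
      (∀ g, ca.piG (sig' g) = g) ∧ ∀ g x, ca.ip ↑(sig' g) (lam x) = 0 := by
  let φ := (ca.ip.comp ((LinearMap.ker ca.rho).subtype.comp sig)).compl₂ lam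
  let κ : ca.Gq →ₗ[A] ca.Ker :=
    (ca.coanchor.comp φ).codRestrict (LinearMap.ker ca.rho) fun _ => ca.rho_coanchor _
  refine existsUnique_of_exists_of_unique ⟨sig - κ, fun g => ?_, fun g x => ?_⟩
    fun τ τ' hτ hτ' => orthogonal_splitting_unique hlam hτ.1 hτ.2 hτ'.1 hτ'.2
  · have h : ca.piG (κ g) = 0 :=
      (Submodule.Quotient.mk_eq_zero ca.perp').2 (ca.coanchor_mem_perp (φ g))
    rw [LinearMap.sub_apply, map_sub, hsig, h, sub_zero]
  · have h : ca.ip (κ g : E) (lam x) = ca.ip (sig g : E) (lam x) :=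
      ip_coanchor_splitting hlam _ _
    rw [LinearMap.sub_apply, Submodule.coe_sub, map_sub, LinearMap.sub_apply, h, sub_self]

lemma exists_dissection {sig : ca.Gq →ₗ[A] ca.Ker} (hlam : ∀ x, ca.rho (lam x) = ↑x)
    (hiso : ∀ x y, ca.ip (lam x) (lam y) = 0) (hsig : ∀ g, ca.piG (sig g) = g)
    (horth : ∀ g x, ca.ip ↑(sig g) (lam x) = 0) :
    ∃ Psi : (Module.Dual A ↥(LinearMap.range ca.rho) × ca.Gq ×
        ↥(LinearMap.range ca.rho)) →ₗ[A] E,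
      (∀ ξ r x, Psi (ξ, r, x) =
        (2:ℝ)⁻¹ • Function.invFun (fun e => ca.ip e) (ξ.comp ca.rho.rangeRestrict)
          + ↑(sig r) + lam x) ∧
      Function.Bijective Psi ∧
      (∀ (ξ η : Module.Dual A ↥(LinearMap.range ca.rho)) (r s : ca.Ker)
          (x y : ↥(LinearMap.range ca.rho)),
        ca.ip (Psi (ξ, ca.piG r, x)) (Psi (η, ca.piG s, y)) =
          (2:ℝ)⁻¹ • ξ y + (2:ℝ)⁻¹ • η x + ca.ip ↑r ↑s) := by
  let c : A := algebraMap ℝ A 2⁻¹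
  have hc : c + c = 1 := by
    rw [← map_add, ← map_one (algebraMap ℝ A)]
    norm_num
  let Psi : (Module.Dual A ↥(LinearMap.range ca.rho) × ca.Gq ×
      ↥(LinearMap.range ca.rho)) →ₗ[A] E :=
    (c • ca.coanchor).coprod (((LinearMap.ker ca.rho).subtype.comp sig).coprod lam)
  have hPsi : ∀ ξ r x, Psi (ξ, r, x) = c • ca.coanchor ξ + ((sig r : E) + lam x) :=
    fun _ _ _ => rfl
  have hker : ∀ r, ca.rho (sig r : E) = 0 := fun r => (sig r).2
  have hcs : ∀ ξ r, ca.ip (ca.coanchor ξ) (sig r : E) = 0 := fun ξ r =>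
    ip_perp_ker (ca.coanchor_mem_perp ξ) (hker r)
  refine ⟨Psi, fun ξ r x => ?_, ⟨?_, fun e => ?_⟩, fun ξ η r s x y => ?_⟩
  · rw [hPsi, invFun_ip_eq_coanchor, ← add_assoc, ← algebraMap_smul A (2 : ℝ)⁻¹ (ca.coanchor ξ)]
  · refine (injective_iff_map_eq_zero Psi).2 ?_
    rintro ⟨ξ, r, x⟩ h
    rw [hPsi] at h
    obtain rfl : x = 0 := by
      have := congrArg ca.rho h
      simp only [map_add, map_smul, rho_coanchor, hker, hlam, smul_zero, zero_add, map_zero] at this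
      exact Subtype.ext this
    obtain rfl : ξ = 0 := by
      ext y
      have := congrArg (fun e => ca.ip e (lam y)) h
      simp only [map_add, map_smul, LinearMap.add_apply, LinearMap.smul_apply, horth,
        ip_coanchor_splitting hlam, map_zero, LinearMap.zero_apply, add_zero, smul_eq_mul] at this
      rw [LinearMap.zero_apply]
      linear_combination 2 * this - ξ y * hc
    have hr : sig r = 0 := by
      refine Subtype.ext ?_
      simpa using h
    obtain rfl : r = 0 := by rw [← hsig r, hr, map_zero]
    rfl
  · let k : ca.Ker := ⟨_, sub_splitting_mem_ker hlam e⟩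
    let p : E := k - sig (ca.piG k)
    have hp : p ∈ ca.perp := sub_mem_perp (hsig (ca.piG k)).symm
    refine ⟨((2 : A) • (ca.ip p).comp lam, ca.piG k, ca.rho.rangeRestrict e), ?_⟩
    have hc2 : c * 2 = 1 := by rw [← hc]; ring
    rw [hPsi, map_smul, smul_smul, hc2, one_smul, coanchor_ip_splitting hlam hp]
    simp only [p, k]
    abel
  · have hrs : ca.ip (sig (ca.piG r) : E) (sig (ca.piG s)) = ca.ip (r : E) s :=
      ip_eq_ip_of_piG_eq (hsig _) (hsig _)
    have hcc : ca.ip (ca.coanchor ξ) (ca.coanchor η) = 0 :=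
      ip_perp_ker (ca.coanchor_mem_perp ξ) (ca.rho_coanchor η)
    rw [hPsi, hPsi, ← algebraMap_smul A (2 : ℝ)⁻¹ (ξ y), ← algebraMap_smul A (2 : ℝ)⁻¹ (η x)]
    simp only [map_add, map_smul, LinearMap.add_apply, LinearMap.smul_apply, smul_eq_mul, hcc, hcs,
      hrs, hiso, horth, ip_coanchor_splitting hlam, ca.ip_symm _ (ca.coanchor η),
      ca.ip_symm (lam x) (sig _ : E)]
    ring

end Splitting

end CourantAlgebroid

open CourantAlgebroid in
/-- Existence of dissections of a regular Courant algebroid. -/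
theorem statement1
    {A : Type} [CommRing A] [Algebra ℝ A]
    {E : Type} [AddCommGroup E] [Module A E] [Module ℝ E] [IsScalarTower ℝ A E]
    (ca : CourantAlgebroid A E) (hreg : ca.IsRegular) :
    -- (a) an isotropic splitting λ of 0 → ker ρ → E → F → 0 exists
    (∃ lam : ↥(LinearMap.range ca.rho) →ₗ[A] E,
      (∀ x, ca.rho (lam x) = ↑x) ∧ (∀ x y, ca.ip (lam x) (lam y) = 0)) ∧
    -- (b) given such λ, there is a unique splitting σ_λ of
    --     0 → (ker ρ)⊥ → ker ρ → 𝒢 → 0 with image orthogonal to λ(F)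
    (∀ lam : ↥(LinearMap.range ca.rho) →ₗ[A] E,
      (∀ x, ca.rho (lam x) = ↑x) → (∀ x y, ca.ip (lam x) (lam y) = 0) →
      ∃! sig : ca.Gq →ₗ[A] ca.Ker,
        (∀ g, ca.piG (sig g) = g) ∧
        (∀ g x, ca.ip ↑(sig g) (lam x) = 0)) ∧
    -- (c) given such λ and σ_λ, the map Ψ_λ(ξ+r+x) = ½Ξ⁻¹ρ*(ξ) + σ_λ(r) + λ(x)
    --     is a dissection of E
    (∀ (lam : ↥(LinearMap.range ca.rho) →ₗ[A] E) (sig : ca.Gq →ₗ[A] ca.Ker),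
      (∀ x, ca.rho (lam x) = ↑x) → (∀ x y, ca.ip (lam x) (lam y) = 0) →
      (∀ g, ca.piG (sig g) = g) → (∀ g x, ca.ip ↑(sig g) (lam x) = 0) →
      ∃ Psi : (Module.Dual A ↥(LinearMap.range ca.rho) × ca.Gq ×
          ↥(LinearMap.range ca.rho)) →ₗ[A] E,
        -- Ψ_λ is given by the formula above
        (∀ ξ r x, Psi (ξ, r, x) =
          (2:ℝ)⁻¹ • Function.invFun (fun e => ca.ip e) (ξ.comp ca.rho.rangeRestrict)
            + ↑(sig r) + lam x) ∧
        -- Ψ_λ is an isomorphism of vector bundles ...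
        Function.Bijective Psi ∧
        -- ... satisfying the dissection compatibility with the pseudo-metrics,
        -- where the pairing on 𝒢 is computed on lifts r, s ∈ Γ(ker ρ)
        (∀ (ξ η : Module.Dual A ↥(LinearMap.range ca.rho)) (r s : ca.Ker)
            (x y : ↥(LinearMap.range ca.rho)),
          ca.ip (Psi (ξ, ca.piG r, x)) (Psi (η, ca.piG s, y)) =
            (2:ℝ)⁻¹ • ξ y + (2:ℝ)⁻¹ • η x + ca.ip ↑r ↑s)) := by
  obtain ⟨⟨lam₀, hlam₀⟩, sig₀, hsig₀⟩ := hreg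
  exact ⟨exists_isotropic_splitting hlam₀,
    fun lam hlam _ => existsUnique_orthogonal_splitting hlam hsig₀,
    fun lam sig hlam hiso hsig horth => exists_dissection hlam hiso hsig horth⟩
end

section
/- Let E be a regular Courant algebroid identified with F*⊕𝒢⊕F via a dissection, and let ∇, R, ℋ be the induced maps ∇_x r = pr_𝒢(x∘r), R(x,y) = pr_𝒢(x∘y), ℋ(x,y,z) = ⟨pr_{F*}(x∘y),z⟩. Then: (a) ∇_{fx}r = f∇_x r and ∇_x(fr) = f∇_x r + (x(f))r for all x ∈ Γ(F), r ∈ Γ(𝒢), f ∈ C^∞(M), i.e. ∇ is an F-connection on 𝒢; (b) R is skew-symmetric and C^∞(M)-bilinear, hence a bundle map ∧²F → 𝒢; (c) ℋ is skew-symmetric and C^∞(M)-trilinear, hence a section of ∧³F*. -/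
namespace CourantAlgebroid

variable {A : Type} [CommRing A] [Algebra ℝ A]
variable {E : Type} [AddCommGroup E] [Module A E] [Module ℝ E] [IsScalarTower ℝ A E]
variable (ca : CourantAlgebroid A E)

/-- `𝒟` vanishes at zero. -/
lemma Dmap_zero : ca.Dmap 0 = 0 := by
  have h := ca.dorf_sym 0 0
  simpa using h.symm

/-- The Dorfman bracket of orthogonal sections is skew-symmetric. -/
lemma dorf_skew_of_ip_eq_zero {e₁ e₂ : E} (h : ca.ip e₁ e₂ = 0) :
    ca.dorf e₁ e₂ = -ca.dorf e₂ e₁ := by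
  have h' := ca.dorf_sym e₁ e₂
  rw [h, ca.Dmap_zero, smul_zero] at h'
  exact eq_neg_of_add_eq_zero_left h'

/-- The left Leibniz rule for orthogonal sections. -/
lemma dorf_smul_left_of_ip_eq_zero (f : A) {e₁ e₂ : E} (h : ca.ip e₁ e₂ = 0) :
    ca.dorf (f • e₁) e₂ = f • ca.dorf e₁ e₂ - ca.rho e₂ f • e₁ := by
  rw [ca.dorf_skew_of_ip_eq_zero (e₁ := f • e₁) (by simp [h]), ca.dorf_leibniz,
    ca.dorf_skew_of_ip_eq_zero h, smul_neg]
  abel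

end CourantAlgebroid

set_option maxHeartbeats 1000000 in
open CourantAlgebroid in
/-- Properties of the data `∇`, `R`, `ℋ` induced by a dissection. -/
theorem statement2
    {A : Type} [CommRing A] [Algebra ℝ A]
    (F : Submodule A (Derivation ℝ A A))
    (hF : ∀ x y : ↥F, ⁅(x : Derivation ℝ A A), (y : Derivation ℝ A A)⁆ ∈ F)
    {G : Type} [AddCommGroup G] [Module A G] [Module ℝ G] [IsScalarTower ℝ A G]
    (ipG : G →ₗ[A] G →ₗ[A] A) (ipG_symm : ∀ r s, ipG r s = ipG s r)
    (ipG_nondeg : ∀ r, (∀ s, ipG r s = 0) → r = 0)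
    -- a Courant algebroid structure on F*⊕𝒢⊕F obtained from a dissection:
    (ca : CourantAlgebroid A (Module.Dual A ↥F × G × ↥F))
    -- the transported anchor is the projection onto F
    (hrho : ∀ p, ca.rho p = ↑p.2.2)
    -- the transported pseudo-metric is ½⟨ξ₁,x₂⟩ + ½⟨ξ₂,x₁⟩ + ⟨r₁,r₂⟩_𝒢
    (hip : ∀ p q, ca.ip p q =
      (2:ℝ)⁻¹ • p.1 q.2.2 + (2:ℝ)⁻¹ • q.1 p.2.2 + ipG p.2.1 q.2.1) :
    -- (a) ∇_x r := pr_𝒢(x∘r) is an F-connection on 𝒢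
    ((∀ (x x' : ↥F) (r : G),
        (ca.dorf (0, 0, x + x') (0, r, 0)).2.1
          = (ca.dorf (0, 0, x) (0, r, 0)).2.1 + (ca.dorf (0, 0, x') (0, r, 0)).2.1) ∧
      (∀ (f : A) (x : ↥F) (r : G),
        (ca.dorf (0, 0, f • x) (0, r, 0)).2.1 = f • (ca.dorf (0, 0, x) (0, r, 0)).2.1) ∧
      (∀ (x : ↥F) (r r' : G),
        (ca.dorf (0, 0, x) (0, r + r', 0)).2.1
          = (ca.dorf (0, 0, x) (0, r, 0)).2.1 + (ca.dorf (0, 0, x) (0, r', 0)).2.1) ∧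
      (∀ (x : ↥F) (f : A) (r : G),
        (ca.dorf (0, 0, x) (0, f • r, 0)).2.1
          = f • (ca.dorf (0, 0, x) (0, r, 0)).2.1 + (x : Derivation ℝ A A) f • r)) ∧
    -- (b) R(x,y) := pr_𝒢(x∘y) is skew-symmetric and C^∞(M)-bilinear,
    --     hence a bundle map ∧²F → 𝒢
    ((∀ x y : ↥F,
        (ca.dorf (0, 0, x) (0, 0, y)).2.1 = - (ca.dorf (0, 0, y) (0, 0, x)).2.1) ∧
      (∀ (f : A) (x x' y : ↥F),
        (ca.dorf (0, 0, f • x + x') (0, 0, y)).2.1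
          = f • (ca.dorf (0, 0, x) (0, 0, y)).2.1 + (ca.dorf (0, 0, x') (0, 0, y)).2.1) ∧
      (∀ (f : A) (x y y' : ↥F),
        (ca.dorf (0, 0, x) (0, 0, f • y + y')).2.1
          = f • (ca.dorf (0, 0, x) (0, 0, y)).2.1 + (ca.dorf (0, 0, x) (0, 0, y')).2.1)) ∧
    -- (c) ℋ(x,y,z) := ⟨pr_{F*}(x∘y),z⟩ is skew-symmetric and C^∞(M)-trilinear,
    --     hence a section of ∧³F*
    ((∀ x y z : ↥F,
        (ca.dorf (0, 0, x) (0, 0, y)).1 z = - (ca.dorf (0, 0, y) (0, 0, x)).1 z) ∧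
      (∀ x y z : ↥F,
        (ca.dorf (0, 0, x) (0, 0, y)).1 z = - (ca.dorf (0, 0, x) (0, 0, z)).1 y) ∧
      (∀ (f : A) (x x' y z : ↥F),
        (ca.dorf (0, 0, f • x + x') (0, 0, y)).1 z
          = f * (ca.dorf (0, 0, x) (0, 0, y)).1 z + (ca.dorf (0, 0, x') (0, 0, y)).1 z) ∧
      (∀ (f : A) (x y z z' : ↥F),
        (ca.dorf (0, 0, x) (0, 0, y)).1 (f • z + z')
          = f * (ca.dorf (0, 0, x) (0, 0, y)).1 z + (ca.dorf (0, 0, x) (0, 0, y)).1 z')) := by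
  have ip_FG (x : ↥F) (r : G) : ca.ip (0, 0, x) (0, r, 0) = 0 := by simp [hip]
  have ip_FF (x y : ↥F) : ca.ip (0, 0, x) (0, 0, y) = 0 := by simp [hip]
  have F_add (x x' : ↥F) :
      ((0, 0, x + x') : Module.Dual A ↥F × G × ↥F) = (0, 0, x) + (0, 0, x') := by simp
  have F_smul (f : A) (x : ↥F) :
      ((0, 0, f • x) : Module.Dual A ↥F × G × ↥F) = f • (0, 0, x) := by simp
  have G_add (r r' : G) :
      ((0, r + r', 0) : Module.Dual A ↥F × G × ↥F) = (0, r, 0) + (0, r', 0) := by simp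
  have G_smul (f : A) (r : G) :
      ((0, f • r, 0) : Module.Dual A ↥F × G × ↥F) = f • (0, r, 0) := by simp
  refine ⟨⟨fun x x' r => ?_, fun f x r => ?_, fun x r r' => ?_, fun x f r => ?_⟩,
    ⟨fun x y => ?_, fun f x x' y => ?_, fun f x y y' => ?_⟩,
    fun x y z => ?_, fun x y z => ?_, fun f x x' y z => ?_, fun f x y z z' => ?_⟩
  · rw [F_add, map_add, LinearMap.add_apply]; rfl
  · rw [F_smul, ca.dorf_smul_left_of_ip_eq_zero f (ip_FG x r)]
    simp
  · rw [G_add, map_add]; rfl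
  · rw [G_smul, ca.dorf_leibniz, hrho]
    simp [add_comm]
  · rw [ca.dorf_skew_of_ip_eq_zero (ip_FF x y)]; rfl
  · rw [F_add, F_smul, map_add, LinearMap.add_apply,
      ca.dorf_smul_left_of_ip_eq_zero f (ip_FF x y)]
    simp
  · rw [F_add, F_smul, map_add, ca.dorf_leibniz]
    simp
  · rw [ca.dorf_skew_of_ip_eq_zero (ip_FF x y)]; rfl
  · have h := ca.rho_ip (0, 0, x) (0, 0, y) (0, 0, z)
    rw [ip_FF, map_zero, hip, hip] at h
    simp only [LinearMap.zero_apply, map_zero, smul_zero, add_zero, zero_add, ← smul_add] at h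
    exact eq_neg_of_add_eq_zero_left ((smul_eq_zero_iff_right (by norm_num)).mp h.symm)
  · rw [F_add, F_smul, map_add, LinearMap.add_apply,
      ca.dorf_smul_left_of_ip_eq_zero f (ip_FF x y)]
    simp
  · simp
end

section
/- Let E be a regular Courant algebroid, Ψ a dissection of E, and ∇^E the E-connection ∇^E_{ξ+r+x}(η+s+y) = (∇^F_x η − ⅓ℋ(x,y,−)) + (∇_x s + ⅔[r,s]_𝒢) + ∇^F_x y built from a torsion-free connection ∇^F on F and the data ∇, R, ℋ induced by Ψ. Then the 3-form C_{∇^E}(e₁,e₂,e₃) = ⅓⟨[e₁,e₂],e₃⟩ − ½⟨∇^E_{e₁}e₂ − ∇^E_{e₂}e₁,e₃⟩ + c.p. does not depend on the choice of ∇^F (it depends only on Ψ, and equals C_Ψ(ξ+r+x, η+s+y, ζ+t+z) = ⟨R(x,y),t⟩_𝒢 + ⟨R(y,z),r⟩_𝒢 + ⟨R(z,x),s⟩_𝒢 − ⟨[r,s]_𝒢,t⟩_𝒢 + ℋ(x,y,z)), and C_Ψ is a naive 3-cocycle: it is a section of ∧³ker ρ with d̆C_Ψ = 0. -/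
/-! Generic Chevalley–Eilenberg-type differentials (for the naive differential `d̆`,
take `act := ρ` and `bk :=` the Courant bracket). -/

section CE
variable {V A : Type} [CommRing A]

/-- differential of a `1`-form -/
def dCE1 (act : V → A → A) (bk : V → V → V) (ω : V → A) (x₀ x₁ : V) : A :=
  act x₀ (ω x₁) - act x₁ (ω x₀) - ω (bk x₀ x₁)

/-- differential of a `2`-form -/
def dCE2 (act : V → A → A) (bk : V → V → V) (ω : V → V → A) (x₀ x₁ x₂ : V) : A :=
  act x₀ (ω x₁ x₂) - act x₁ (ω x₀ x₂) + act x₂ (ω x₀ x₁)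
    - ω (bk x₀ x₁) x₂ + ω (bk x₀ x₂) x₁ - ω (bk x₁ x₂) x₀

/-- differential of a `3`-form -/
def dCE3 (act : V → A → A) (bk : V → V → V) (ω : V → V → V → A)
    (x₀ x₁ x₂ x₃ : V) : A :=
  act x₀ (ω x₁ x₂ x₃) - act x₁ (ω x₀ x₂ x₃) + act x₂ (ω x₀ x₁ x₃)
    - act x₃ (ω x₀ x₁ x₂)
    - ω (bk x₀ x₁) x₂ x₃ + ω (bk x₀ x₂) x₁ x₃ - ω (bk x₀ x₃) x₁ x₂
    - ω (bk x₁ x₂) x₀ x₃ + ω (bk x₁ x₃) x₀ x₂ - ω (bk x₂ x₃) x₀ x₁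

/-- differential of a `4`-form -/
def dCE4 (act : V → A → A) (bk : V → V → V) (ω : V → V → V → V → A)
    (x₀ x₁ x₂ x₃ x₄ : V) : A :=
  act x₀ (ω x₁ x₂ x₃ x₄) - act x₁ (ω x₀ x₂ x₃ x₄) + act x₂ (ω x₀ x₁ x₃ x₄)
    - act x₃ (ω x₀ x₁ x₂ x₄) + act x₄ (ω x₀ x₁ x₂ x₃)
    - ω (bk x₀ x₁) x₂ x₃ x₄ + ω (bk x₀ x₂) x₁ x₃ x₄ - ω (bk x₀ x₃) x₁ x₂ x₄
    + ω (bk x₀ x₄) x₁ x₂ x₃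
    - ω (bk x₁ x₂) x₀ x₃ x₄ + ω (bk x₁ x₃) x₀ x₂ x₄ - ω (bk x₁ x₄) x₀ x₂ x₃
    - ω (bk x₂ x₃) x₀ x₁ x₄ + ω (bk x₂ x₄) x₀ x₁ x₃
    - ω (bk x₃ x₄) x₀ x₁ x₂

end CE

variable {A : Type} [CommRing A] [Algebra ℝ A]
variable {E : Type} [AddCommGroup E] [Module A E] [Module ℝ E] [IsScalarTower ℝ A E]

/-- The Courant bracket (skew-symmetrization of the Dorfman bracket). -/
noncomputable def courantBk (ca : CourantAlgebroid A E) (e₁ e₂ : E) : E :=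
  (2:ℝ)⁻¹ • (ca.dorf e₁ e₂ - ca.dorf e₂ e₁)

section Std
variable (F : Submodule A (Derivation ℝ A A))
variable {G : Type} [AddCommGroup G] [Module A G] [Module ℝ G] [IsScalarTower ℝ A G]

/-- The explicit standard 3-form
`C_Ψ(ξ+r+x, η+s+y, ζ+t+z) = ⟨R(x,y),t⟩ + ⟨R(y,z),r⟩ + ⟨R(z,x),s⟩ − ⟨[r,s],t⟩ + ℋ(x,y,z)`
written in terms of the data `R`, `ℋ` induced by the dissection. -/
def stdCform (lG : G →ₗ[A] G →ₗ[A] G) (ipG : G →ₗ[A] G →ₗ[A] A)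
    (ca : CourantAlgebroid A (Module.Dual A ↥F × G × ↥F))
    (p q w : Module.Dual A ↥F × G × ↥F) : A :=
  ipG ((ca.dorf (0, 0, p.2.2) (0, 0, q.2.2)).2.1) w.2.1
    + ipG ((ca.dorf (0, 0, q.2.2) (0, 0, w.2.2)).2.1) p.2.1
    + ipG ((ca.dorf (0, 0, w.2.2) (0, 0, p.2.2)).2.1) q.2.1
    - ipG (lG p.2.1 q.2.1) w.2.1
    + (ca.dorf (0, 0, p.2.2) (0, 0, q.2.2)).1 w.2.2

end Std

theorem two_mul_half_smul {B : Type} [CommRing B] [Algebra ℝ B] (a : B) :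
    2 * ((2 : ℝ)⁻¹ • a) = a := by
  rw [two_mul, ← add_smul]; norm_num

namespace CourantAlgebroid

theorem ip_dorf_add_ip_dorf_swap (ca : CourantAlgebroid A E) (p q w : E) :
    ca.ip (ca.dorf p q) w + ca.ip (ca.dorf q p) w = ca.rho w (ca.ip p q) := by
  rw [← LinearMap.add_apply, ← map_add, ca.dorf_sym, ← ca.ip_D, two_smul, map_add,
    LinearMap.add_apply, two_mul]

theorem ip_dorf_add_ip_dorf_right (ca : CourantAlgebroid A E) (p q w : E) :
    ca.ip (ca.dorf p q) w + ca.ip (ca.dorf p w) q = ca.rho p (ca.ip q w) := by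
  rw [ca.rho_ip, ca.ip_symm q]

theorem prod_eq_add_add {M N P : Type} [AddCommGroup M] [AddCommGroup N] [AddCommGroup P]
    (p : M × N × P) : p = (p.1, 0, 0) + (0, p.2.1, 0) + (0, 0, p.2.2) := by
  simp

section Dissection

variable {F : Submodule A (Derivation ℝ A A)}
variable {G : Type} [AddCommGroup G] [Module A G] [Module ℝ G] [IsScalarTower ℝ A G]

/-- The Lie bracket on sections of an involutive `F`. -/
def leafBracket (hF : ∀ x y : ↥F, ⁅(x : Derivation ℝ A A), (y : Derivation ℝ A A)⁆ ∈ F)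
    (x y : ↥F) : ↥F :=
  ⟨⁅(x : Derivation ℝ A A), (y : Derivation ℝ A A)⁆, hF x y⟩

/-- The connection `∇_x s` on `𝒢` induced by a dissection. -/
def nabla (ca : CourantAlgebroid A (Module.Dual A ↥F × G × ↥F)) (x : ↥F) (s : G) : G :=
  (ca.dorf (0, 0, x) (0, s, 0)).2.1

/-- The form `R(x, y)` induced by a dissection. -/
def curv (ca : CourantAlgebroid A (Module.Dual A ↥F × G × ↥F)) (x y : ↥F) : G :=
  (ca.dorf (0, 0, x) (0, 0, y)).2.1

/-- The form `ℋ(x, y, z)` induced by a dissection. -/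
def hform (ca : CourantAlgebroid A (Module.Dual A ↥F × G × ↥F)) (x y z : ↥F) : A :=
  (ca.dorf (0, 0, x) (0, 0, y)).1 z

/-- `ca` is a Courant algebroid on `F*⊕𝒢⊕F` whose anchor, pairing and bracket on `𝒢` are the
ones coming from a dissection. -/
structure IsDissected (lG : G →ₗ[A] G →ₗ[A] G) (ipG : G →ₗ[A] G →ₗ[A] A)
    (ca : CourantAlgebroid A (Module.Dual A ↥F × G × ↥F)) : Prop where
  lie_mem : ∀ x y : ↥F, ⁅(x : Derivation ℝ A A), (y : Derivation ℝ A A)⁆ ∈ F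
  lG_skew : ∀ r s, lG r s = - lG s r
  lG_jacobi : ∀ r s t, lG r (lG s t) = lG (lG r s) t + lG s (lG r t)
  ipG_symm : ∀ r s, ipG r s = ipG s r
  ipG_nondeg : ∀ r, (∀ s, ipG r s = 0) → r = 0
  ipG_ad : ∀ r s t, ipG (lG r s) t + ipG s (lG r t) = 0
  rho_eq : ∀ p, ca.rho p = ↑p.2.2
  ip_eq : ∀ p q, ca.ip p q =
    (2:ℝ)⁻¹ • p.1 q.2.2 + (2:ℝ)⁻¹ • q.1 p.2.2 + ipG p.2.1 q.2.1
  dorf_eq : ∀ r s : G, (ca.dorf (0, r, 0) (0, s, 0)).2.1 = lG r s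

variable {lG : G →ₗ[A] G →ₗ[A] G} {ipG : G →ₗ[A] G →ₗ[A] A}
variable {ca : CourantAlgebroid A (Module.Dual A ↥F × G × ↥F)}

namespace IsDissected

theorem dorf_snd_snd (h : IsDissected lG ipG ca) (p q : Module.Dual A ↥F × G × ↥F) :
    (ca.dorf p q).2.2 = leafBracket h.lie_mem p.2.2 q.2.2 := by
  apply Subtype.ext
  rw [← h.rho_eq, ca.rho_dorf, h.rho_eq, h.rho_eq, leafBracket]

theorem leafBracket_zero_left (h : IsDissected lG ipG ca) (y : ↥F) : leafBracket h.lie_mem 0 y = 0 := by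
  simp [leafBracket]

theorem leafBracket_zero_right (h : IsDissected lG ipG ca) (x : ↥F) : leafBracket h.lie_mem x 0 = 0 := by
  simp [leafBracket]

theorem leafBracket_swap (h : IsDissected lG ipG ca) (x y : ↥F) :
    leafBracket h.lie_mem y x = - leafBracket h.lie_mem x y := by
  apply Subtype.ext
  simp [leafBracket]

theorem ip_dual (h : IsDissected lG ipG ca) (v : Module.Dual A ↥F × G × ↥F) (ζ : Module.Dual A ↥F) :
    ca.ip v (ζ, 0, 0) = (2:ℝ)⁻¹ • ζ v.2.2 := by
  simp [h.ip_eq]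

theorem ip_lie (h : IsDissected lG ipG ca) (v : Module.Dual A ↥F × G × ↥F) (t : G) :
    ca.ip v (0, t, 0) = ipG v.2.1 t := by
  simp [h.ip_eq]

theorem ip_leaf (h : IsDissected lG ipG ca) (v : Module.Dual A ↥F × G × ↥F) (z : ↥F) :
    ca.ip v (0, 0, z) = (2:ℝ)⁻¹ • v.1 z := by
  simp [h.ip_eq]

theorem ip_dorf_dual (h : IsDissected lG ipG ca) (p q : Module.Dual A ↥F × G × ↥F) (ζ : Module.Dual A ↥F) :
    ca.ip (ca.dorf p q) (ζ, 0, 0) = (2:ℝ)⁻¹ • ζ (leafBracket h.lie_mem p.2.2 q.2.2) := by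
  rw [h.ip_dual, h.dorf_snd_snd]

theorem ip_dorf_right_dual (h : IsDissected lG ipG ca) (p w : Module.Dual A ↥F × G × ↥F) (η : Module.Dual A ↥F) :
    ca.ip (ca.dorf p (η, 0, 0)) w = (p.2.2 : Derivation ℝ A A) ((2:ℝ)⁻¹ • η w.2.2)
      - (2:ℝ)⁻¹ • η (leafBracket h.lie_mem p.2.2 w.2.2) := by
  rw [← h.rho_eq, ← h.ip_dual, ca.ip_symm w, ← ca.ip_dorf_add_ip_dorf_right, h.ip_dorf_dual]
  ring

theorem ip_dorf_left_dual (h : IsDissected lG ipG ca) (q w : Module.Dual A ↥F × G × ↥F) (ξ : Module.Dual A ↥F) :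
    ca.ip (ca.dorf (ξ, 0, 0) q) w = (w.2.2 : Derivation ℝ A A) ((2:ℝ)⁻¹ • ξ q.2.2)
      - (q.2.2 : Derivation ℝ A A) ((2:ℝ)⁻¹ • ξ w.2.2)
      + (2:ℝ)⁻¹ • ξ (leafBracket h.lie_mem q.2.2 w.2.2) := by
  have h1 := ca.ip_dorf_add_ip_dorf_swap q (ξ, 0, 0) w
  rw [h.ip_dorf_right_dual, h.ip_dual, h.rho_eq] at h1
  linear_combination h1

theorem curv_swap (h : IsDissected lG ipG ca) (x y : ↥F) : curv ca y x = - curv ca x y := by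
  rw [eq_neg_iff_add_eq_zero]
  refine h.ipG_nondeg _ fun t => ?_
  have h1 := ca.ip_dorf_add_ip_dorf_swap (0, 0, y) (0, 0, x) (0, t, 0)
  simpa [h.ip_lie, h.rho_eq, curv] using h1

theorem hform_swap (h : IsDissected lG ipG ca) (x y z : ↥F) : hform ca y x z = - hform ca x y z := by
  have h1 := ca.ip_dorf_add_ip_dorf_swap (0, 0, y) (0, 0, x) (0, 0, z)
  rw [h.ip_leaf, h.ip_leaf, h.ip_leaf, ← smul_add] at h1
  rw [← two_mul_half_smul (hform ca y x z), ← two_mul_half_smul (hform ca x y z)]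
  simp only [hform]
  simp only [LinearMap.zero_apply, smul_zero, map_zero, smul_add] at h1
  linear_combination 2 * h1

theorem hform_swap_right (h : IsDissected lG ipG ca) (x y z : ↥F) : hform ca x z y = - hform ca x y z := by
  have h1 := ca.ip_dorf_add_ip_dorf_right (0, 0, x) (0, 0, y) (0, 0, z)
  rw [h.ip_leaf, h.ip_leaf, h.ip_leaf, ← smul_add] at h1
  rw [← two_mul_half_smul (hform ca x y z), ← two_mul_half_smul (hform ca x z y)]
  simp only [hform]
  simp only [LinearMap.zero_apply, smul_zero, map_zero, smul_add] at h1
  linear_combination 2 * h1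

theorem hform_cyclic (h : IsDissected lG ipG ca) (x y z : ↥F) : hform ca x y z = hform ca z x y := by
  rw [h.hform_swap x z, h.hform_swap_right x y, neg_neg]

theorem ip_dorf_leaf_lie_leaf (h : IsDissected lG ipG ca) (x z : ↥F) (s : G) :
    ca.ip (ca.dorf (0, 0, x) (0, s, 0)) (0, 0, z) = - ipG (curv ca x z) s := by
  have h1 := ca.ip_dorf_add_ip_dorf_right (0, 0, x) (0, s, 0) (0, 0, z)
  rw [h.ip_lie, h.ip_leaf (0, s, 0)] at h1
  simp only [LinearMap.zero_apply, smul_zero, map_zero] at h1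
  rw [curv]
  linear_combination h1

theorem ip_dorf_lie_leaf_leaf (h : IsDissected lG ipG ca) (y z : ↥F) (r : G) :
    ca.ip (ca.dorf (0, r, 0) (0, 0, y)) (0, 0, z) = ipG (curv ca y z) r := by
  have h1 := ca.ip_dorf_add_ip_dorf_swap (0, 0, y) (0, r, 0) (0, 0, z)
  rw [h.ip_dorf_leaf_lie_leaf, h.ip_lie] at h1
  simp only [LinearMap.zero_apply, map_zero] at h1
  linear_combination h1

theorem ip_dorf_lie_leaf_lie (h : IsDissected lG ipG ca) (y : ↥F) (r t : G) :
    ca.ip (ca.dorf (0, r, 0) (0, 0, y)) (0, t, 0) = - ipG (nabla ca y r) t := by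
  have h1 := ca.ip_dorf_add_ip_dorf_swap (0, 0, y) (0, r, 0) (0, t, 0)
  rw [h.ip_lie (ca.dorf (0, 0, y) _), h.ip_lie (0, 0, y)] at h1
  simp only [LinearMap.zero_apply, map_zero] at h1
  rw [nabla]
  linear_combination h1

theorem ip_dorf_lie_lie_leaf (h : IsDissected lG ipG ca) (z : ↥F) (r s : G) :
    ca.ip (ca.dorf (0, r, 0) (0, s, 0)) (0, 0, z) = ipG (nabla ca z r) s := by
  have h1 := ca.ip_dorf_add_ip_dorf_right (0, r, 0) (0, s, 0) (0, 0, z)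
  rw [h.ip_dorf_lie_leaf_lie, h.ip_leaf (0, s, 0)] at h1
  simp only [LinearMap.zero_apply, smul_zero, map_zero] at h1
  linear_combination h1

/-- The Dorfman bracket in terms of the data induced by a dissection. -/
theorem ip_dorf (h : IsDissected lG ipG ca) (p q w : Module.Dual A ↥F × G × ↥F) :
    ca.ip (ca.dorf p q) w =
      (2:ℝ)⁻¹ • hform ca p.2.2 q.2.2 w.2.2
      + ipG (curv ca p.2.2 q.2.2) w.2.1 - ipG (curv ca p.2.2 w.2.2) q.2.1
      + ipG (curv ca q.2.2 w.2.2) p.2.1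
      + ipG (nabla ca p.2.2 q.2.1) w.2.1 - ipG (nabla ca q.2.2 p.2.1) w.2.1
      + ipG (nabla ca w.2.2 p.2.1) q.2.1 + ipG (lG p.2.1 q.2.1) w.2.1
      + (2:ℝ)⁻¹ • ((p.2.2 : Derivation ℝ A A) (q.1 w.2.2)
        - q.1 (leafBracket h.lie_mem p.2.2 w.2.2)
        + (w.2.2 : Derivation ℝ A A) (p.1 q.2.2) - (q.2.2 : Derivation ℝ A A) (p.1 w.2.2)
        + p.1 (leafBracket h.lie_mem q.2.2 w.2.2)
        + w.1 (leafBracket h.lie_mem p.2.2 q.2.2)) := by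
  obtain ⟨ξ, r, x⟩ := p
  obtain ⟨η, s, y⟩ := q
  obtain ⟨ζ, t, z⟩ := w
  conv_lhs => rw [prod_eq_add_add (ξ, r, x), prod_eq_add_add (η, s, y), prod_eq_add_add (ζ, t, z)]
  simp only [map_add, LinearMap.add_apply]
  simp only [h.ip_dorf_dual, h.ip_dorf_left_dual, h.ip_dorf_right_dual,
    h.ip_dorf_leaf_lie_leaf, h.ip_dorf_lie_leaf_leaf, h.ip_dorf_lie_leaf_lie,
    h.ip_dorf_lie_lie_leaf, h.ip_lie (ca.dorf (0, 0, x) (0, s, 0)),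
    h.ip_lie (ca.dorf (0, 0, x) (0, 0, y)), h.ip_leaf (ca.dorf (0, 0, x) (0, 0, y)),
    h.ip_lie (ca.dorf (0, r, 0) (0, s, 0)), h.dorf_eq,
    h.leafBracket_zero_left, h.leafBracket_zero_right, map_zero, smul_zero,
    Submodule.coe_zero, Derivation.zero_apply, Derivation.map_smul]
  simp only [hform, curv, nabla, smul_add, smul_sub]
  ring

theorem nabla_zero_right (x : ↥F) : nabla ca x 0 = 0 := by
  change (ca.dorf (0, 0, x) 0).2.1 = 0
  simp

theorem nabla_zero_left (s : G) : nabla ca 0 s = 0 := by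
  change (ca.dorf 0 (0, s, 0)).2.1 = 0
  simp

theorem curv_zero_right (x : ↥F) : curv ca x 0 = 0 := by
  change (ca.dorf (0, 0, x) 0).2.1 = 0
  simp

theorem curv_zero_left (x : ↥F) : curv ca 0 x = 0 := by
  change (ca.dorf 0 (0, 0, x)).2.1 = 0
  simp

theorem hform_zero_right (x y : ↥F) : hform ca x y 0 = 0 := by
  simp [hform]

/-- The `𝒢`-component of the Dorfman bracket. -/
theorem dorf_snd_fst (h : IsDissected lG ipG ca) (p q : Module.Dual A ↥F × G × ↥F) :
    (ca.dorf p q).2.1 = curv ca p.2.2 q.2.2 + nabla ca p.2.2 q.2.1 - nabla ca q.2.2 p.2.1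
      + lG p.2.1 q.2.1 := by
  rw [← sub_eq_zero]
  refine h.ipG_nondeg _ fun t => ?_
  have h1 := h.ip_dorf p q (0, t, 0)
  rw [h.ip_lie] at h1
  simp only [hform_zero_right, curv_zero_right, nabla_zero_left, h.leafBracket_zero_right, map_zero,
    LinearMap.zero_apply, smul_zero, Submodule.coe_zero, Derivation.zero_apply, sub_zero,
    add_zero, zero_add] at h1
  simp only [map_add, map_sub, LinearMap.add_apply, LinearMap.sub_apply, h1]
  ring

theorem courantBk_snd_snd (h : IsDissected lG ipG ca) (p q : Module.Dual A ↥F × G × ↥F) :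
    (courantBk ca p q).2.2 = leafBracket h.lie_mem p.2.2 q.2.2 := by
  rw [courantBk, Prod.smul_snd, Prod.smul_snd, Prod.snd_sub, Prod.snd_sub, h.dorf_snd_snd,
    h.dorf_snd_snd, h.leafBracket_swap p.2.2]
  module

theorem courantBk_snd_fst (h : IsDissected lG ipG ca) (p q : Module.Dual A ↥F × G × ↥F) :
    (courantBk ca p q).2.1 = curv ca p.2.2 q.2.2 + nabla ca p.2.2 q.2.1 - nabla ca q.2.2 p.2.1
      + lG p.2.1 q.2.1 := by
  rw [courantBk, Prod.smul_snd, Prod.smul_fst, Prod.snd_sub, Prod.fst_sub, h.dorf_snd_fst,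
    h.dorf_snd_fst, h.curv_swap p.2.2, h.lG_skew q.2.1]
  module

theorem nabla_metric (h : IsDissected lG ipG ca) (x : ↥F) (s t : G) :
    (x : Derivation ℝ A A) (ipG s t) = ipG (nabla ca x s) t + ipG s (nabla ca x t) := by
  have h1 := ca.rho_ip (0, 0, x) (0, s, 0) (0, t, 0)
  rwa [h.ip_lie, h.ip_lie, ca.ip_symm (0, s, 0), h.ip_lie, h.rho_eq, h.ipG_symm _ s] at h1

theorem nabla_lie (h : IsDissected lG ipG ca) (x : ↥F) (s t : G) :
    nabla ca x (lG s t) = lG (nabla ca x s) t + lG s (nabla ca x t) := by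
  have h1 := congrArg (fun e => e.2.1) (ca.dorf_jacobi (0, 0, x) (0, s, 0) (0, t, 0))
  simp only [Prod.snd_add, Prod.fst_add, h.dorf_snd_fst, h.dorf_snd_snd] at h1
  simpa [nabla_zero_left, curv_zero_right, curv_zero_left, nabla_zero_right, h.leafBracket_zero_left,
    h.leafBracket_zero_right] using h1

theorem bianchi (h : IsDissected lG ipG ca) (x y z : ↥F) :
    nabla ca x (curv ca y z) - nabla ca y (curv ca x z) + nabla ca z (curv ca x y)
      - curv ca (leafBracket h.lie_mem x y) z + curv ca (leafBracket h.lie_mem x z) y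
      - curv ca (leafBracket h.lie_mem y z) x = 0 := by
  have h1 := congrArg (fun e => e.2.1) (ca.dorf_jacobi (0, 0, x) (0, 0, y) (0, 0, z))
  simp only [Prod.snd_add, Prod.fst_add, h.dorf_snd_fst, h.dorf_snd_snd, nabla_zero_right,
    map_zero, LinearMap.zero_apply, add_zero, sub_zero] at h1
  rw [h.curv_swap (leafBracket h.lie_mem y z) x, h.curv_swap (leafBracket h.lie_mem x z) y] at h1
  linear_combination (norm := module) h1

theorem d_hform (h : IsDissected lG ipG ca) (x y z w : ↥F) :
    (x : Derivation ℝ A A) (hform ca y z w) - (y : Derivation ℝ A A) (hform ca x z w)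
      + (z : Derivation ℝ A A) (hform ca x y w) - (w : Derivation ℝ A A) (hform ca x y z)
      - hform ca (leafBracket h.lie_mem x y) z w + hform ca (leafBracket h.lie_mem x z) y w
      - hform ca (leafBracket h.lie_mem x w) y z - hform ca (leafBracket h.lie_mem y z) x w
      + hform ca (leafBracket h.lie_mem y w) x z - hform ca (leafBracket h.lie_mem z w) x y
      = 2 * (ipG (curv ca x y) (curv ca z w) - ipG (curv ca x z) (curv ca y w)
        + ipG (curv ca x w) (curv ca y z)) := by
  have h1 := congrArg (fun e => ca.ip e (0, 0, w))
    (ca.dorf_jacobi (0, 0, x) (0, 0, y) (0, 0, z))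
  have hH (x y z : ↥F) : (ca.dorf (0, 0, x) (0, 0, y)).1 z = hform ca x y z := rfl
  simp only [map_add, LinearMap.add_apply, h.ip_dorf, h.dorf_snd_fst, h.dorf_snd_snd,
    nabla_zero_right, hH, map_zero, LinearMap.zero_apply, add_zero, sub_zero, zero_add] at h1
  have h2 := congrArg (2 * ·) h1
  simp only [mul_add, mul_sub, two_mul_half_smul] at h2
  rw [h.hform_swap (leafBracket _ y z) x, h.hform_swap (leafBracket _ x z) y,
    h.hform_cyclic y z (leafBracket _ x w), h.hform_cyclic x y (leafBracket _ z w),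
    h.hform_cyclic x z (leafBracket _ y w), h.ipG_symm (curv ca z w),
    h.ipG_symm (curv ca y w)] at h2
  linear_combination h2

theorem stdCform_eq (p q w : Module.Dual A ↥F × G × ↥F) :
    stdCform F lG ipG ca p q w = ipG (curv ca p.2.2 q.2.2) w.2.1
      + ipG (curv ca q.2.2 w.2.2) p.2.1 + ipG (curv ca w.2.2 p.2.2) q.2.1
      - ipG (lG p.2.1 q.2.1) w.2.1 + hform ca p.2.2 q.2.2 w.2.2 := rfl

theorem ip_lG_swap (h : IsDissected lG ipG ca) (r s t : G) : ipG (lG r s) t = - ipG (lG s r) t := by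
  rw [h.lG_skew, map_neg, LinearMap.neg_apply]

theorem ip_lG_swap_right (h : IsDissected lG ipG ca) (r s t : G) : ipG (lG r t) s = - ipG (lG r s) t := by
  rw [h.ipG_symm _ s]
  linear_combination h.ipG_ad r s t

theorem ip_lG_symm (h : IsDissected lG ipG ca) (r s t : G) : ipG r (lG s t) = ipG (lG r s) t := by
  linear_combination h.ipG_ad s r t - h.ip_lG_swap s r t

theorem ip_lG_cyclic (h : IsDissected lG ipG ca) (r s t : G) : ipG (lG r s) t = ipG (lG t r) s := by
  rw [h.ipG_symm, h.ip_lG_symm]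

theorem stdCform_swap_left (h : IsDissected lG ipG ca) (p q w : Module.Dual A ↥F × G × ↥F) :
    stdCform F lG ipG ca p q w = - stdCform F lG ipG ca q p w := by
  simp only [stdCform_eq]
  rw [h.curv_swap p.2.2 q.2.2, h.curv_swap w.2.2 q.2.2, h.curv_swap p.2.2 w.2.2,
    h.hform_swap p.2.2, h.ip_lG_swap q.2.1]
  simp only [map_neg, LinearMap.neg_apply]
  ring

theorem stdCform_swap_right (h : IsDissected lG ipG ca) (p q w : Module.Dual A ↥F × G × ↥F) :
    stdCform F lG ipG ca p q w = - stdCform F lG ipG ca p w q := by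
  simp only [stdCform_eq]
  rw [h.curv_swap p.2.2 w.2.2, h.curv_swap w.2.2 q.2.2, h.curv_swap p.2.2 q.2.2,
    h.hform_swap_right p.2.2 q.2.2, h.ip_lG_swap_right p.2.1 q.2.1]
  simp only [map_neg, LinearMap.neg_apply]
  ring

theorem stdCform_smul_add_right (h : IsDissected lG ipG ca) (f : A) (p q w w' : Module.Dual A ↥F × G × ↥F) :
    stdCform F lG ipG ca p q (f • w + w')
      = f * stdCform F lG ipG ca p q w + stdCform F lG ipG ca p q w' := by
  have hc (x z z' : ↥F) : curv ca x (f • z + z') = f • curv ca x z + curv ca x z' := by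
    have e : ((0, 0, f • z + z') : Module.Dual A ↥F × G × ↥F) = f • (0, 0, z) + (0, 0, z') := by
      simp
    rw [curv, e, map_add, ca.dorf_leibniz]
    simp [curv]
  simp only [stdCform_eq, Prod.snd_add, Prod.fst_add, Prod.smul_snd, Prod.smul_fst]
  rw [h.curv_swap p.2.2 (f • _ + _), hc, hc, h.curv_swap p.2.2 w.2.2, h.curv_swap p.2.2 w'.2.2]
  simp only [hform, map_neg, LinearMap.neg_apply, map_add, map_smul, LinearMap.add_apply,
    LinearMap.smul_apply, smul_eq_mul]
  ring

theorem stdCform_smul_add_left (h : IsDissected lG ipG ca) (f : A) (p p' q w : Module.Dual A ↥F × G × ↥F) :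
    stdCform F lG ipG ca (f • p + p') q w
      = f * stdCform F lG ipG ca p q w + stdCform F lG ipG ca p' q w := by
  have hc (p : Module.Dual A ↥F × G × ↥F) :
      stdCform F lG ipG ca p q w = stdCform F lG ipG ca q w p := by
    rw [h.stdCform_swap_left, h.stdCform_swap_right, neg_neg]
  rw [hc, hc p, hc p', h.stdCform_smul_add_right]

theorem snd_eq_zero_of_mem_perp (h : IsDissected lG ipG ca) {p : Module.Dual A ↥F × G × ↥F} (hp : p ∈ ca.perp) :
    p.2 = 0 := by
  refine Prod.ext (h.ipG_nondeg _ fun s => ?_) ?_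
  · rw [← h.ip_lie]
    exact hp _ (by simp [h.rho_eq])
  · have h0 : ((0, 0, p.2.2) : Module.Dual A ↥F × G × ↥F) = 0 := by
      refine ca.ip_nondeg.injective (LinearMap.ext fun v => ?_)
      have h1 := hp (v.1, 0, 0) (by simp [h.rho_eq])
      rw [h.ip_dual] at h1
      simp [h.ip_eq, h1]
    exact congrArg (fun e => e.2.2) h0

theorem stdCform_eq_zero_of_mem_perp (h : IsDissected lG ipG ca) {p : Module.Dual A ↥F × G × ↥F} (hp : p ∈ ca.perp)
    (q w : Module.Dual A ↥F × G × ↥F) : stdCform F lG ipG ca p q w = 0 := by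
  have h0 := h.snd_eq_zero_of_mem_perp hp
  have h1 : stdCform F lG ipG ca p q w = stdCform F lG ipG ca 0 q w := by
    simp only [stdCform, h0, Prod.snd_zero]
  simpa [h1] using h.stdCform_smul_add_left 1 0 0 q w

theorem dCE3_stdCform (h : IsDissected lG ipG ca) (e₀ e₁ e₂ e₃ : Module.Dual A ↥F × G × ↥F) :
    dCE3 (fun e f => ca.rho e f) (courantBk ca) (stdCform F lG ipG ca) e₀ e₁ e₂ e₃ = 0 := by
  obtain ⟨ξ₀, r₀, x₀⟩ := e₀
  obtain ⟨ξ₁, r₁, x₁⟩ := e₁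
  obtain ⟨ξ₂, r₂, x₂⟩ := e₂
  obtain ⟨ξ₃, r₃, x₃⟩ := e₃
  have c20 := h.curv_swap x₀ x₂
  have c30 := h.curv_swap x₀ x₃
  have c31 := h.curv_swap x₁ x₃
  have cl (x y z : ↥F) := h.curv_swap (leafBracket h.lie_mem y z) x
  have b (x y z : ↥F) (r : G) := congrArg (fun s => ipG s r) (h.bianchi x y z)
  have n (x : ↥F) (r s t : G) := congrArg (fun u => ipG u t) (h.nabla_lie x r s)
  have j := congrArg (fun u => ipG u r₃) (h.lG_jacobi r₀ r₁ r₂)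
  have hd := h.d_hform x₀ x₁ x₂ x₃
  have lN (x : ↥F) (s a c : G) := h.ip_lG_swap a (nabla ca x s) c
  have lL (a b c d : G) := h.ip_lG_swap a (lG b c) d
  have iN (x : ↥F) (s a b : G) := h.ip_lG_cyclic a b (nabla ca x s)
  have iC (x y : ↥F) (a b : G) := h.ip_lG_symm (curv ca x y) a b
  have k (a b c d : G) : ipG (lG (lG a b) c) d = ipG (lG (lG c d) a) b := by
    rw [← h.ip_lG_symm, h.ipG_symm, h.ip_lG_symm]
  simp only [map_add, map_sub, LinearMap.add_apply, LinearMap.sub_apply, map_zero,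
    LinearMap.zero_apply, lN, lL] at b n j
  simp only [dCE3, h.rho_eq, stdCform_eq, h.courantBk_snd_fst, h.courantBk_snd_snd, map_add,
    map_sub, LinearMap.add_apply, LinearMap.sub_apply, h.nabla_metric, cl, c20, c30,
    c31, map_neg, LinearMap.neg_apply, iN, iC]
  rw [h.ipG_symm (curv ca x₂ x₃) (curv ca x₀ x₁), h.ipG_symm (curv ca x₁ x₃) (curv ca x₀ x₂),
    h.ipG_symm (curv ca x₁ x₂) (curv ca x₀ x₃)]
  linear_combination hd + b x₀ x₁ x₂ r₃ - b x₀ x₁ x₃ r₂ + b x₀ x₂ x₃ r₁ - b x₁ x₂ x₃ r₀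
    - n x₀ r₁ r₂ r₃ + n x₁ r₀ r₂ r₃ - n x₂ r₀ r₁ r₃ + n x₃ r₀ r₁ r₂ - 2 * j
    + k r₀ r₃ r₁ r₂ - k r₁ r₃ r₀ r₂ + k r₂ r₃ r₀ r₁

theorem three_form_eq_stdCform (h : IsDissected lG ipG ca) (nF : ↥F → ↥F → ↥F)
    (torsion_free : ∀ x y, nF x y - nF y x = leafBracket h.lie_mem x y)
    (nE : (Module.Dual A ↥F × G × ↥F) → (Module.Dual A ↥F × G × ↥F) →
      (Module.Dual A ↥F × G × ↥F))
    (hnE_leaf : ∀ p q, (nE p q).2.2 = nF p.2.2 q.2.2)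
    (hnE_lie : ∀ p q, (nE p q).2.1 = nabla ca p.2.2 q.2.1 + (2/3 : ℝ) • lG p.2.1 q.2.1)
    (hnE_dual : ∀ p q (z : ↥F), (nE p q).1 z =
      (p.2.2 : Derivation ℝ A A) (q.1 z) - q.1 (nF p.2.2 z)
        - (3:ℝ)⁻¹ • hform ca p.2.2 q.2.2 z)
    (p q w : Module.Dual A ↥F × G × ↥F) :
    (3:ℝ)⁻¹ • (ca.ip (courantBk ca p q) w + ca.ip (courantBk ca q w) p
        + ca.ip (courantBk ca w p) q)
      - (2:ℝ)⁻¹ • (ca.ip (nE p q - nE q p) w + ca.ip (nE q w - nE w q) p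
        + ca.ip (nE w p - nE p w) q)
    = stdCform F lG ipG ca p q w := by
  have t (x y : ↥F) : nF y x = nF x y - leafBracket h.lie_mem x y := by
    rw [← torsion_free x y]; abel
  obtain ⟨ξ, r, x⟩ := p
  obtain ⟨η, s, y⟩ := q
  obtain ⟨ζ, u, z⟩ := w
  simp only [courantBk, LinearMap.map_smul_of_tower, LinearMap.smul_apply, map_sub, LinearMap.sub_apply,
    h.ip_dorf, h.ip_eq (nE _ _), hnE_leaf, hnE_lie, hnE_dual, stdCform_eq]
  rw [t x y, t y z, t x z, h.leafBracket_swap x y, h.leafBracket_swap x z,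
    h.leafBracket_swap y z, h.curv_swap x y, h.curv_swap x z, h.curv_swap y z,
    h.hform_swap x y, h.hform_cyclic z x y, h.hform_cyclic y z x,
    h.hform_cyclic z y x, h.hform_swap_right x y z]
  simp only [map_add, map_sub, map_neg, LinearMap.add_apply, LinearMap.neg_apply,
    LinearMap.map_smul_of_tower, LinearMap.smul_apply]
  rw [h.ip_lG_swap s r u, h.ip_lG_cyclic s u r, h.ip_lG_swap u s r, h.ip_lG_cyclic s u r,
    h.ip_lG_cyclic u r s, h.ip_lG_cyclic s u r, h.ip_lG_swap_right r s u]
  module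

end IsDissected
end Dissection
end CourantAlgebroid

open CourantAlgebroid in
/-- `C_{∇^E}` does not depend on the torsion-free connection `∇^F`
(it equals the explicit standard 3-form `C_Ψ`), and `C_Ψ` is a naive 3-cocycle. -/
theorem statement4
    {A : Type} [CommRing A] [Algebra ℝ A]
    (F : Submodule A (Derivation ℝ A A))
    (hF : ∀ x y : ↥F, ⁅(x : Derivation ℝ A A), (y : Derivation ℝ A A)⁆ ∈ F)
    {G : Type} [AddCommGroup G] [Module A G] [Module ℝ G] [IsScalarTower ℝ A G]
    (lG : G →ₗ[A] G →ₗ[A] G) (ipG : G →ₗ[A] G →ₗ[A] A)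
    (lG_skew : ∀ r s, lG r s = - lG s r)
    (lG_jacobi : ∀ r s t, lG r (lG s t) = lG (lG r s) t + lG s (lG r t))
    (ipG_symm : ∀ r s, ipG r s = ipG s r)
    (ipG_nondeg : ∀ r, (∀ s, ipG r s = 0) → r = 0)
    (ipG_ad : ∀ r s t, ipG (lG r s) t + ipG s (lG r t) = 0)
    -- a Courant algebroid structure on F*⊕𝒢⊕F obtained from a dissection
    (ca : CourantAlgebroid A (Module.Dual A ↥F × G × ↥F))
    (hrho : ∀ p, ca.rho p = ↑p.2.2)
    (hip : ∀ p q, ca.ip p q =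
      (2:ℝ)⁻¹ • p.1 q.2.2 + (2:ℝ)⁻¹ • q.1 p.2.2 + ipG p.2.1 q.2.1)
    (hG : ∀ r s : G, (ca.dorf (0, r, 0) (0, s, 0)).2.1 = lG r s) :
    -- (1) for every torsion-free connection ∇^F on F and associated E-connection ∇^E,
    --     the 3-form C_{∇^E} equals the explicit standard 3-form C_Ψ; in particular it
    --     does not depend on the chosen ∇^F, only on the dissection Ψ
    (∀ nF : ↥F → ↥F → ↥F,
      (∀ x x' y, nF (x + x') y = nF x y + nF x' y) →
      (∀ (f : A) x y, nF (f • x) y = f • nF x y) →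
      (∀ x y y', nF x (y + y') = nF x y + nF x y') →
      (∀ x (f : A) y, nF x (f • y) = f • nF x y + (x : Derivation ℝ A A) f • y) →
      (∀ x y, nF x y - nF y x = (⟨⁅(x : Derivation ℝ A A), y⁆, hF x y⟩ : ↥F)) →
      ∀ nE : (Module.Dual A ↥F × G × ↥F) → (Module.Dual A ↥F × G × ↥F) →
          (Module.Dual A ↥F × G × ↥F),
        (∀ p q, (nE p q).2.2 = nF p.2.2 q.2.2) →
        (∀ p q, (nE p q).2.1 =
          (ca.dorf (0, 0, p.2.2) (0, q.2.1, 0)).2.1 + (2/3 : ℝ) • lG p.2.1 q.2.1) →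
        (∀ p q (z : ↥F), (nE p q).1 z =
          (p.2.2 : Derivation ℝ A A) (q.1 z) - q.1 (nF p.2.2 z)
            - (3:ℝ)⁻¹ • (ca.dorf (0, 0, p.2.2) (0, 0, q.2.2)).1 z) →
        ∀ p q w,
          (3:ℝ)⁻¹ • (ca.ip (courantBk ca p q) w + ca.ip (courantBk ca q w) p
              + ca.ip (courantBk ca w p) q)
            - (2:ℝ)⁻¹ • (ca.ip (nE p q - nE q p) w + ca.ip (nE q w - nE w q) p
              + ca.ip (nE w p - nE p w) q)
          = stdCform F lG ipG ca p q w) ∧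
    -- (2) C_Ψ is a naive 3-cochain: alternating, C^∞(M)-trilinear, and a section of
    --     ∧³ ker ρ (i.e. it annihilates (ker ρ)⊥)
    (∀ p q w, stdCform F lG ipG ca p q w = - stdCform F lG ipG ca q p w) ∧
    (∀ p q w, stdCform F lG ipG ca p q w = - stdCform F lG ipG ca p w q) ∧
    (∀ (f : A) p p' q w, stdCform F lG ipG ca (f • p + p') q w
      = f * stdCform F lG ipG ca p q w + stdCform F lG ipG ca p' q w) ∧
    (∀ p q w, p ∈ ca.perp → stdCform F lG ipG ca p q w = 0) ∧
    -- (3) C_Ψ is closed for the naive differential d̆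
    (∀ e₀ e₁ e₂ e₃,
      dCE3 (fun e f => ca.rho e f) (courantBk ca) (stdCform F lG ipG ca) e₀ e₁ e₂ e₃
        = 0) := by
  have h : IsDissected lG ipG ca :=
    ⟨hF, lG_skew, lG_jacobi, ipG_symm, ipG_nondeg, ipG_ad, hrho, hip, hG⟩
  refine ⟨?_, h.stdCform_swap_left, h.stdCform_swap_right, h.stdCform_smul_add_left,
    fun p q w hp => h.stdCform_eq_zero_of_mem_perp hp q w, ?_⟩
  · intro nF _ _ _ _ torsion_free nE hnE_leaf hnE_lie hnE_dual
    exact h.three_form_eq_stdCform nF torsion_free nE hnE_leaf hnE_lie hnE_dual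
  · exact h.dCE3_stdCform
end

section
/- Let 𝒜 be a quadratic Lie algebroid with anchor a, F = a(𝒜), 𝒢 = ker a, and let κ be a hoist of 𝒜 with curvature R^κ. Then the 4-form ⟨R^κ∧R^κ⟩ ∈ Γ(∧⁴F*) is d^F-closed, and its class in the leafwise de Rham cohomology H⁴(F) does not depend on the choice of the hoist κ (this class is the first Pontryagin class of 𝒜). -/
/-- A quadratic Lie algebroid (in algebraic form): a Lie algebroid over `A` (playing the
role of `C^∞(M)`) together with a fiberwise nondegenerate ad-invariant symmetric bilinear
form on the kernel of the anchor (here given as a symmetric bilinear form on `L`,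
only its restriction to `ker a` being relevant). -/
structure QuadLieAlgebroid (A : Type) [CommRing A] [Algebra ℝ A]
    (L : Type) [AddCommGroup L] [Module A L] [Module ℝ L] [IsScalarTower ℝ A L] where
  /-- the anchor `a` -/
  anchor : L →ₗ[A] Derivation ℝ A A
  /-- the Lie bracket (ℝ-bilinear) -/
  bracket : L →ₗ[ℝ] L →ₗ[ℝ] L
  bracket_skew : ∀ X Y, bracket X Y = - bracket Y X
  jacobi : ∀ X Y Z,
    bracket X (bracket Y Z) = bracket (bracket X Y) Z + bracket Y (bracket X Z)
  leibniz : ∀ (X : L) (f : A) (Y : L),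
    bracket X (f • Y) = f • bracket X Y + anchor X f • Y
  anchor_bracket : ∀ X Y, anchor (bracket X Y) = ⁅anchor X, anchor Y⁆
  /-- the pairing `⟨-,-⟩_𝒢` on `𝒢 = ker a` -/
  ipG : L →ₗ[A] L →ₗ[A] A
  ipG_symm : ∀ r s, ipG r s = ipG s r
  ipG_nondeg : ∀ r ∈ LinearMap.ker anchor,
    (∀ s ∈ LinearMap.ker anchor, ipG r s = 0) → r = 0
  /-- `a(X)⟨r,s⟩_𝒢 = ⟨[X,r],s⟩_𝒢 + ⟨r,[X,s]⟩_𝒢` (for `X ∈ ker a` this is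
  ad-invariance of the fiberwise pairing) -/
  ipG_inv : ∀ (X r s : L), r ∈ LinearMap.ker anchor → s ∈ LinearMap.ker anchor →
    anchor X (ipG r s) = ipG (bracket X r) s + ipG r (bracket X s)

namespace QuadLieAlgebroid

variable {A : Type} [CommRing A] [Algebra ℝ A]
variable {L : Type} [AddCommGroup L] [Module A L] [Module ℝ L] [IsScalarTower ℝ A L]
variable (Q : QuadLieAlgebroid A L)

/-- `F := a(𝒜)`, the characteristic distribution. -/
abbrev Fq : Submodule A (Derivation ℝ A A) := LinearMap.range Q.anchor

/-- `𝒢 := ker a`. -/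
abbrev Kq : Submodule A L := LinearMap.ker Q.anchor

lemma lie_mem_range (x y : ↥Q.Fq) :
    ⁅(x : Derivation ℝ A A), (y : Derivation ℝ A A)⁆ ∈ Q.Fq := by
  obtain ⟨X, hX⟩ := x.2
  obtain ⟨Y, hY⟩ := y.2
  exact ⟨Q.bracket X Y, by rw [Q.anchor_bracket, hX, hY]⟩

/-- the (leafwise) Lie bracket of vector fields tangent to `F` -/
def fbk (x y : ↥Q.Fq) : ↥Q.Fq :=
  ⟨⁅(x : Derivation ℝ A A), (y : Derivation ℝ A A)⁆, Q.lie_mem_range x y⟩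

/-- the action of vector fields tangent to `F` on functions -/
def fact (x : ↥Q.Fq) (f : A) : A := (x : Derivation ℝ A A) f

lemma bracket_mem_ker (X : L) {r : L} (hr : r ∈ Q.Kq) : Q.bracket X r ∈ Q.Kq := by
  have h : Q.anchor (Q.bracket X r) = ⁅Q.anchor X, Q.anchor r⁆ := Q.anchor_bracket X r
  rw [LinearMap.mem_ker] at hr ⊢
  rw [h, hr, lie_zero]

/-- A hoist of `𝒜`: a section `κ : F → 𝒜` of the anchor. -/
structure Hoist where
  toFun : ↥Q.Fq →ₗ[A] L
  sect : ∀ x, Q.anchor (toFun x) = ↑x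

variable {Q}

/-- The curvature `R^κ(x,y) = [κ(x),κ(y)] − κ([x,y])` of a hoist. -/
def Hoist.curv (κ : Q.Hoist) (x y : ↥Q.Fq) : L :=
  Q.bracket (κ.toFun x) (κ.toFun y) - κ.toFun (Q.fbk x y)

lemma Hoist.curv_mem_ker (κ : Q.Hoist) (x y : ↥Q.Fq) : κ.curv x y ∈ Q.Kq := by
  rw [LinearMap.mem_ker, Hoist.curv, map_sub, Q.anchor_bracket, κ.sect, κ.sect, κ.sect]
  show ⁅(x : Derivation ℝ A A), (y : Derivation ℝ A A)⁆ - ↑(Q.fbk x y) = 0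
  rw [fbk]
  exact sub_self _

variable (Q)

/-- The 4-form `⟨R^κ∧R^κ⟩` representing the first Pontryagin class. -/
noncomputable def pont4 (κ : Q.Hoist) (x₁ x₂ x₃ x₄ : ↥Q.Fq) : A :=
  (4:ℝ)⁻¹ • ∑ σ : Equiv.Perm (Fin 4),
    (Equiv.Perm.sign σ : ℤ) •
      Q.ipG (κ.curv (![x₁, x₂, x₃, x₄] (σ 0)) (![x₁, x₂, x₃, x₄] (σ 1)))
            (κ.curv (![x₁, x₂, x₃, x₄] (σ 2)) (![x₁, x₂, x₃, x₄] (σ 3)))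

end QuadLieAlgebroid

open Equiv.Perm in
lemma sum_perm_fin_four_sign {M : Type*} [AddCommGroup M]
    (g : Fin 4 → Fin 4 → Fin 4 → Fin 4 → M)
    (h₁ : ∀ i j k l, g i j k l = - g j i k l) (h₂ : ∀ i j k l, g i j k l = g k l i j) :
    ∑ σ : Equiv.Perm (Fin 4), (Equiv.Perm.sign σ : ℤ) • g (σ 0) (σ 1) (σ 2) (σ 3)
      = (8 : ℤ) • (g 0 1 2 3 - g 0 2 1 3 + g 0 3 1 2) := by
  have e : (Finset.univ : Finset (Equiv.Perm (Fin 4))).val.map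
      (fun σ => ((Equiv.Perm.sign σ : ℤ), σ 0, σ 1, σ 2, σ 3)) =
      {(1, 0, 1, 2, 3), (-1, 0, 1, 3, 2), (-1, 0, 2, 1, 3), (1, 0, 2, 3, 1), (1, 0, 3, 1, 2),
       (-1, 0, 3, 2, 1), (-1, 1, 0, 2, 3), (1, 1, 0, 3, 2), (1, 1, 2, 0, 3), (-1, 1, 2, 3, 0),
       (-1, 1, 3, 0, 2), (1, 1, 3, 2, 0), (1, 2, 0, 1, 3), (-1, 2, 0, 3, 1), (-1, 2, 1, 0, 3),
       (1, 2, 1, 3, 0), (1, 2, 3, 0, 1), (-1, 2, 3, 1, 0), (-1, 3, 0, 1, 2), (1, 3, 0, 2, 1),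
       (1, 3, 1, 0, 2), (-1, 3, 1, 2, 0), (-1, 3, 2, 0, 1), (1, 3, 2, 1, 0)} := by decide
  have h₃ : ∀ i j k l, g i j k l = - g i j l k := fun i j k l => by
    rw [h₂, h₁, h₂]
  have := congrArg (fun s => (s.map fun p : ℤ × Fin 4 × Fin 4 × Fin 4 × Fin 4 =>
    p.1 • g p.2.1 p.2.2.1 p.2.2.2.1 p.2.2.2.2).sum) e
  simp only [Multiset.map_map, Function.comp_def] at this
  refine Eq.trans this ?_
  simp only [Multiset.insert_eq_cons, Multiset.map_cons, Multiset.map_singleton,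
    Multiset.sum_cons, Multiset.sum_singleton]
  rw [h₃ 0 1 3 2, h₃ 0 2 3 1, h₃ 0 3 2 1, h₁ 1 0 2 3, h₁ 1 0 3 2, h₃ 0 1 3 2, h₂ 1 2 0 3,
    h₂ 1 2 3 0, h₁ 3 0 1 2, h₂ 1 3 0 2, h₂ 1 3 2 0, h₁ 2 0 1 3, h₁ 2 0 3 1, h₃ 0 2 3 1,
    h₂ 2 1 0 3, h₃ 0 3 2 1, h₂ 2 1 3 0, h₁ 3 0 2 1, h₃ 0 3 2 1, h₂ 2 3 0 1, h₂ 2 3 1 0,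
    h₁ 1 0 2 3, h₂ 3 1 0 2, h₃ 0 2 3 1, h₂ 3 1 2 0, h₁ 2 0 3 1, h₃ 0 2 3 1,
    h₂ 3 2 0 1, h₃ 0 1 3 2, h₂ 3 2 1 0, h₁ 1 0 3 2, h₃ 0 1 3 2]
  module

namespace QuadLieAlgebroid

variable {A : Type} [CommRing A] [Algebra ℝ A]
variable {L : Type} [AddCommGroup L] [Module A L] [Module ℝ L] [IsScalarTower ℝ A L]
variable {Q : QuadLieAlgebroid A L}

lemma fbk_skew (x y : ↥Q.Fq) : Q.fbk x y = - Q.fbk y x :=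
  Subtype.ext (lie_skew _ _).symm

lemma fbk_jacobi (x y z : ↥Q.Fq) :
    Q.fbk x (Q.fbk y z) = Q.fbk (Q.fbk x y) z + Q.fbk y (Q.fbk x z) :=
  Subtype.ext (leibniz_lie _ _ _)

lemma fbk_smul_add_left (f : A) (x x' y : ↥Q.Fq) :
    Q.fbk (f • x + x') y = f • Q.fbk x y - Q.fact y f • x + Q.fbk x' y := by
  ext g
  simp [fbk, fact, Derivation.commutator_apply]
  ring

lemma bracket_smul_left (f : A) (X Y : L) :
    Q.bracket (f • X) Y = f • Q.bracket X Y - Q.anchor Y f • X := by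
  rw [Q.bracket_skew, Q.leibniz, Q.bracket_skew Y X]
  module

/-- Ad-invariance, in the form of associativity of the pairing on `ker a`. -/
lemma ipG_bracket_assoc {r s t : L} (hr : r ∈ Q.Kq) (hs : s ∈ Q.Kq) (ht : t ∈ Q.Kq) :
    Q.ipG r (Q.bracket s t) = Q.ipG (Q.bracket r s) t := by
  have h := Q.ipG_inv s r t hr ht
  rw [LinearMap.mem_ker.1 hs, Q.bracket_skew s r] at h
  simp only [Derivation.coe_zero, Pi.zero_apply, map_neg, LinearMap.neg_apply] at h
  linear_combination -h

namespace Hoist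

lemma curv_skew (κ : Q.Hoist) (x y : ↥Q.Fq) : κ.curv x y = - κ.curv y x := by
  rw [curv, curv, Q.bracket_skew, fbk_skew, map_neg]
  abel

lemma curv_smul_add_left (κ : Q.Hoist) (f : A) (x x' y : ↥Q.Fq) :
    κ.curv (f • x + x') y = f • κ.curv x y + κ.curv x' y := by
  simp only [curv, fbk_smul_add_left, map_add, map_sub, map_smul, LinearMap.add_apply,
    bracket_smul_left, κ.sect, fact]
  module

/-- The second Bianchi identity. -/
lemma bianchi (κ : Q.Hoist) (x y z : ↥Q.Fq) :
    Q.bracket (κ.toFun x) (κ.curv y z) - Q.bracket (κ.toFun y) (κ.curv x z)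
      + Q.bracket (κ.toFun z) (κ.curv x y)
      = κ.curv (Q.fbk x y) z - κ.curv (Q.fbk x z) y + κ.curv (Q.fbk y z) x := by
  simp only [curv, map_sub]
  rw [Q.jacobi (κ.toFun x), Q.bracket_skew (κ.toFun z) (Q.bracket _ _),
    Q.bracket_skew (κ.toFun x) (κ.toFun (Q.fbk y z)),
    Q.bracket_skew (κ.toFun y) (κ.toFun (Q.fbk x z)),
    Q.bracket_skew (κ.toFun z) (κ.toFun (Q.fbk x y)),
    fbk_skew (Q.fbk x z) y, fbk_skew (Q.fbk y z) x, fbk_jacobi x y z]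
  simp only [map_add, map_neg]
  abel

lemma fact_ipG (κ : Q.Hoist) (x : ↥Q.Fq) {r s : L} (hr : r ∈ Q.Kq) (hs : s ∈ Q.Kq) :
    Q.fact x (Q.ipG r s)
      = Q.ipG (Q.bracket (κ.toFun x) r) s + Q.ipG r (Q.bracket (κ.toFun x) s) := by
  rw [fact, ← κ.sect x, Q.ipG_inv _ _ _ hr hs]

end Hoist

lemma fact_add (x : ↥Q.Fq) (f g : A) : Q.fact x (f + g) = Q.fact x f + Q.fact x g :=
  map_add _ _ _

lemma fact_sub (x : ↥Q.Fq) (f g : A) : Q.fact x (f - g) = Q.fact x f - Q.fact x g :=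
  map_sub _ _ _

lemma fact_two_mul (x : ↥Q.Fq) (f : A) : Q.fact x (2 * f) = 2 * Q.fact x f := by
  rw [two_mul, fact_add, two_mul]

lemma pont4_eq (κ : Q.Hoist) (x₁ x₂ x₃ x₄ : ↥Q.Fq) :
    Q.pont4 κ x₁ x₂ x₃ x₄ = 2 * (Q.ipG (κ.curv x₁ x₂) (κ.curv x₃ x₄)
      - Q.ipG (κ.curv x₁ x₃) (κ.curv x₂ x₄) + Q.ipG (κ.curv x₁ x₄) (κ.curv x₂ x₃)) := by
  let v := ![x₁, x₂, x₃, x₄]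
  have h := sum_perm_fin_four_sign
    (fun i j k l => Q.ipG (κ.curv (v i) (v j)) (κ.curv (v k) (v l)))
    (fun i j k l => by rw [κ.curv_skew (v i), map_neg, LinearMap.neg_apply])
    (fun i j k l => Q.ipG_symm _ _)
  rw [pont4, h, ← Int.cast_smul_eq_zsmul ℝ, smul_smul,
    show (4 : ℝ)⁻¹ * ((8 : ℤ) : ℝ) = 2 by norm_num, two_smul, two_mul]
  rfl

lemma dCE4_pont4 (κ : Q.Hoist) (x₀ x₁ x₂ x₃ x₄ : ↥Q.Fq) :
    dCE4 Q.fact Q.fbk (Q.pont4 κ) x₀ x₁ x₂ x₃ x₄ = 0 := by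
  have act : ∀ x y z u v, Q.fact x (Q.ipG (κ.curv y z) (κ.curv u v))
      = Q.ipG (Q.bracket (κ.toFun x) (κ.curv y z)) (κ.curv u v)
        + Q.ipG (Q.bracket (κ.toFun x) (κ.curv u v)) (κ.curv y z) := fun x y z u v => by
    rw [κ.fact_ipG x (κ.curv_mem_ker y z) (κ.curv_mem_ker u v), Q.ipG_symm (κ.curv y z)]
  have B : ∀ x y z u v,
      Q.ipG (Q.bracket (κ.toFun x) (κ.curv y z)) (κ.curv u v)
        - Q.ipG (Q.bracket (κ.toFun y) (κ.curv x z)) (κ.curv u v)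
        + Q.ipG (Q.bracket (κ.toFun z) (κ.curv x y)) (κ.curv u v)
      = Q.ipG (κ.curv (Q.fbk x y) z) (κ.curv u v) - Q.ipG (κ.curv (Q.fbk x z) y) (κ.curv u v)
        + Q.ipG (κ.curv (Q.fbk y z) x) (κ.curv u v) := fun x y z u v => by
    simpa only [map_add, map_sub, LinearMap.add_apply, LinearMap.sub_apply]
      using congrArg (fun r => Q.ipG r (κ.curv u v)) (κ.bianchi x y z)
  simp only [dCE4, pont4_eq, fact_add, fact_sub, fact_two_mul, act]
  linear_combination 2 * (B x₀ x₁ x₂ x₃ x₄ - B x₀ x₁ x₃ x₂ x₄ + B x₀ x₁ x₄ x₂ x₃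
    + B x₀ x₂ x₃ x₁ x₄ - B x₀ x₂ x₄ x₁ x₃ + B x₀ x₃ x₄ x₁ x₂
    - B x₁ x₂ x₃ x₀ x₄ + B x₁ x₂ x₄ x₀ x₃ - B x₁ x₃ x₄ x₀ x₂ + B x₂ x₃ x₄ x₀ x₁)

namespace Hoist

/-- The difference `κ' - κ` of two hoists. -/
def diff (κ κ' : Q.Hoist) : ↥Q.Fq →ₗ[A] L := κ'.toFun - κ.toFun

lemma diff_mem_ker (κ κ' : Q.Hoist) (x : ↥Q.Fq) : κ.diff κ' x ∈ Q.Kq := by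
  rw [LinearMap.mem_ker, diff, LinearMap.sub_apply, map_sub, κ.sect, κ'.sect, sub_self]

lemma toFun_add_diff (κ κ' : Q.Hoist) (x : ↥Q.Fq) : κ'.toFun x = κ.toFun x + κ.diff κ' x := by
  rw [diff, LinearMap.sub_apply, add_sub_cancel]

/-- Change of the curvature under a change of hoist. -/
lemma curv_eq_add (κ κ' : Q.Hoist) (x y : ↥Q.Fq) :
    κ'.curv x y = κ.curv x y + (Q.bracket (κ.toFun x) (κ.diff κ' y)
      - Q.bracket (κ.toFun y) (κ.diff κ' x) - κ.diff κ' (Q.fbk x y))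
      + Q.bracket (κ.diff κ' x) (κ.diff κ' y) := by
  rw [curv, curv, κ.toFun_add_diff κ', κ.toFun_add_diff κ', κ.toFun_add_diff κ',
    Q.bracket_skew (κ.toFun y)]
  simp only [map_add, LinearMap.add_apply]
  abel

/-- The Chern–Simons transgression `3`-form
`⟨J ∧ (R^κ + R^κ')⟩ - ⅓ ⟨J ∧ [J ∧ J]⟩` with `J = κ' - κ`. -/
def transgression (κ κ' : Q.Hoist) (x y z : ↥Q.Fq) : A :=
  Q.ipG (κ.diff κ' x) (κ.curv y z + κ'.curv y z)
    - Q.ipG (κ.diff κ' y) (κ.curv x z + κ'.curv x z)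
    + Q.ipG (κ.diff κ' z) (κ.curv x y + κ'.curv x y)
    - Q.ipG (κ.diff κ' x) (Q.bracket (κ.diff κ' y) (κ.diff κ' z))

lemma transgression_smul_add_left (κ κ' : Q.Hoist) (f : A) (x x' y z : ↥Q.Fq) :
    κ.transgression κ' (f • x + x') y z
      = f * κ.transgression κ' x y z + κ.transgression κ' x' y z := by
  simp only [transgression, curv_smul_add_left, map_add, map_smul, LinearMap.add_apply,
    LinearMap.smul_apply, smul_eq_mul]
  ring

lemma transgression_swap_right (κ κ' : Q.Hoist) (x y z : ↥Q.Fq) :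
    κ.transgression κ' x y z = - κ.transgression κ' x z y := by
  rw [transgression, transgression, κ.curv_skew y z, κ'.curv_skew y z,
    Q.bracket_skew (κ.diff κ' y)]
  simp only [map_add, map_neg]
  ring

lemma transgression_swap_left (κ κ' : Q.Hoist) (x y z : ↥Q.Fq) :
    κ.transgression κ' x y z = - κ.transgression κ' y x z := by
  rw [transgression, transgression, κ.curv_skew x y, κ'.curv_skew x y,
    ipG_bracket_assoc (κ.diff_mem_ker κ' x) (κ.diff_mem_ker κ' y) (κ.diff_mem_ker κ' z),
    ipG_bracket_assoc (κ.diff_mem_ker κ' y) (κ.diff_mem_ker κ' x) (κ.diff_mem_ker κ' z),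
    Q.bracket_skew (κ.diff κ' x)]
  simp only [map_add, map_neg, LinearMap.neg_apply]
  ring

/-- `⟨[J ∧ J] ∧ [J ∧ J]⟩ = 0`. -/
lemma ipG_bracket_diff_jacobi (κ κ' : Q.Hoist) (x y z w : ↥Q.Fq) :
    Q.ipG (Q.bracket (κ.diff κ' x) (κ.diff κ' y)) (Q.bracket (κ.diff κ' z) (κ.diff κ' w))
      - Q.ipG (Q.bracket (κ.diff κ' x) (κ.diff κ' z)) (Q.bracket (κ.diff κ' y) (κ.diff κ' w))
      + Q.ipG (Q.bracket (κ.diff κ' x) (κ.diff κ' w)) (Q.bracket (κ.diff κ' y) (κ.diff κ' z))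
      = 0 := by
  have hJ := κ.diff_mem_ker κ'
  have hB : ∀ u v, Q.bracket (κ.diff κ' u) (κ.diff κ' v) ∈ Q.Kq :=
    fun u v => Q.bracket_mem_ker _ (hJ v)
  rw [← ipG_bracket_assoc (hJ x) (hJ y) (hB z w), ← ipG_bracket_assoc (hJ x) (hJ z) (hB y w),
    ← ipG_bracket_assoc (hJ x) (hJ w) (hB y z), Q.jacobi (κ.diff κ' y),
    Q.bracket_skew (κ.diff κ' w)]
  simp only [map_add, map_neg]
  ring

set_option maxHeartbeats 1000000 in
lemma pont4_sub_pont4 (κ κ' : Q.Hoist) (x₁ x₂ x₃ x₄ : ↥Q.Fq) :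
    Q.pont4 κ' x₁ x₂ x₃ x₄ - Q.pont4 κ x₁ x₂ x₃ x₄
      = dCE3 Q.fact Q.fbk (κ.transgression κ') x₁ x₂ x₃ x₄ := by
  have hJ := κ.diff_mem_ker κ'
  have hB : ∀ u v, Q.bracket (κ.diff κ' u) (κ.diff κ' v) ∈ Q.Kq :=
    fun u v => Q.bracket_mem_ker _ (hJ v)
  have act : ∀ x y u v, Q.fact x (Q.ipG (κ.diff κ' y) (κ.curv u v))
      = Q.ipG (Q.bracket (κ.toFun x) (κ.diff κ' y)) (κ.curv u v)
        + Q.ipG (κ.diff κ' y) (Q.bracket (κ.toFun x) (κ.curv u v)) := fun x y u v =>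
    κ.fact_ipG x (hJ y) (κ.curv_mem_ker u v)
  have act' : ∀ x y u v, Q.fact x (Q.ipG (κ.diff κ' y) (κ'.curv u v))
      = Q.ipG (Q.bracket (κ.toFun x) (κ.diff κ' y)) (κ'.curv u v)
        + Q.ipG (Q.bracket (κ.diff κ' x) (κ.diff κ' y)) (κ'.curv u v)
        + Q.ipG (κ.diff κ' y) (Q.bracket (κ'.toFun x) (κ'.curv u v)) := fun x y u v => by
    rw [κ'.fact_ipG x (hJ y) (κ'.curv_mem_ker u v), ← LinearMap.add_apply, ← map_add,
      ← LinearMap.add_apply, ← map_add, ← κ.toFun_add_diff κ']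
  have actB : ∀ x y u v,
      Q.fact x (Q.ipG (κ.diff κ' y) (Q.bracket (κ.diff κ' u) (κ.diff κ' v)))
      = Q.ipG (Q.bracket (κ.toFun x) (κ.diff κ' y)) (Q.bracket (κ.diff κ' u) (κ.diff κ' v))
        - Q.ipG (Q.bracket (κ.toFun x) (κ.diff κ' u)) (Q.bracket (κ.diff κ' y) (κ.diff κ' v))
        + Q.ipG (Q.bracket (κ.toFun x) (κ.diff κ' v)) (Q.bracket (κ.diff κ' y) (κ.diff κ' u)) :=
    fun x y u v => by
      have hu := Q.bracket_mem_ker (κ.toFun x) (hJ u)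
      have hv := Q.bracket_mem_ker (κ.toFun x) (hJ v)
      rw [κ.fact_ipG x (hJ y) (hB u v), Q.jacobi (κ.toFun x), map_add,
        ipG_bracket_assoc (hJ y) (hJ u) hv, Q.ipG_symm _ (Q.bracket (κ.toFun x) (κ.diff κ' v)),
        Q.bracket_skew (Q.bracket (κ.toFun x) (κ.diff κ' u)), map_neg,
        ipG_bracket_assoc (hJ y) (hJ v) hu,
        Q.ipG_symm _ (Q.bracket (κ.toFun x) (κ.diff κ' u))]
      ring
  have B : ∀ (κ₁ : Q.Hoist) (x y z u : ↥Q.Fq),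
      Q.ipG (κ.diff κ' u) (Q.bracket (κ₁.toFun x) (κ₁.curv y z))
        - Q.ipG (κ.diff κ' u) (Q.bracket (κ₁.toFun y) (κ₁.curv x z))
        + Q.ipG (κ.diff κ' u) (Q.bracket (κ₁.toFun z) (κ₁.curv x y))
      = Q.ipG (κ.diff κ' u) (κ₁.curv (Q.fbk x y) z)
        - Q.ipG (κ.diff κ' u) (κ₁.curv (Q.fbk x z) y)
        + Q.ipG (κ.diff κ' u) (κ₁.curv (Q.fbk y z) x) := fun κ₁ x y z u => by
    simpa only [map_add, map_sub] using congrArg (Q.ipG (κ.diff κ' u)) (κ₁.bianchi x y z)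
  have C : ∀ x y r, Q.ipG (κ'.curv x y) r = Q.ipG (κ.curv x y) r
      + (Q.ipG (Q.bracket (κ.toFun x) (κ.diff κ' y)) r
        - Q.ipG (Q.bracket (κ.toFun y) (κ.diff κ' x)) r - Q.ipG (κ.diff κ' (Q.fbk x y)) r)
      + Q.ipG (Q.bracket (κ.diff κ' x) (κ.diff κ' y)) r := fun x y r => by
    simpa only [map_add, map_sub, LinearMap.add_apply, LinearMap.sub_apply]
      using congrArg (fun s => Q.ipG s r) (κ.curv_eq_add κ' x y)
  have K := κ.ipG_bracket_diff_jacobi κ' x₁ x₂ x₃ x₄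
  have S : ∀ r s, Q.ipG r s - Q.ipG s r = 0 := fun r s => sub_eq_zero.2 (Q.ipG_symm r s)
  have E : ∀ x y u v,
      Q.ipG (κ'.curv x y) (κ'.curv u v) - Q.ipG (κ.curv x y) (κ.curv u v)
        + Q.ipG (κ'.curv x y) (κ.curv u v) - Q.ipG (κ'.curv u v) (κ.curv x y)
      = (Q.ipG (Q.bracket (κ.toFun x) (κ.diff κ' y)) (κ.curv u v)
          - Q.ipG (Q.bracket (κ.toFun y) (κ.diff κ' x)) (κ.curv u v)
          - Q.ipG (κ.diff κ' (Q.fbk x y)) (κ.curv u v))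
        + (Q.ipG (Q.bracket (κ.toFun x) (κ.diff κ' y)) (κ'.curv u v)
          - Q.ipG (Q.bracket (κ.toFun y) (κ.diff κ' x)) (κ'.curv u v)
          - Q.ipG (κ.diff κ' (Q.fbk x y)) (κ'.curv u v))
        - (Q.ipG (Q.bracket (κ.toFun x) (κ.diff κ' y)) (Q.bracket (κ.diff κ' u) (κ.diff κ' v))
          - Q.ipG (Q.bracket (κ.toFun y) (κ.diff κ' x)) (Q.bracket (κ.diff κ' u) (κ.diff κ' v))
          - Q.ipG (κ.diff κ' (Q.fbk x y)) (Q.bracket (κ.diff κ' u) (κ.diff κ' v)))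
        + Q.ipG (Q.bracket (κ.diff κ' x) (κ.diff κ' y)) (κ.curv u v)
        + Q.ipG (Q.bracket (κ.diff κ' x) (κ.diff κ' y)) (κ'.curv u v)
        + Q.ipG (Q.bracket (κ.diff κ' u) (κ.diff κ' v)) (κ'.curv x y)
        - Q.ipG (Q.bracket (κ.diff κ' u) (κ.diff κ' v)) (κ.curv x y)
        - Q.ipG (Q.bracket (κ.diff κ' x) (κ.diff κ' y))
            (Q.bracket (κ.diff κ' u) (κ.diff κ' v)) := fun x y u v => by
    linear_combination C x y (κ.curv u v) + C x y (κ'.curv u v)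
      - C x y (Q.bracket (κ.diff κ' u) (κ.diff κ' v)) + S (κ.curv x y) (κ'.curv u v)
      + S (κ'.curv x y) (Q.bracket (κ.diff κ' u) (κ.diff κ' v))
      - S (κ.curv x y) (Q.bracket (κ.diff κ' u) (κ.diff κ' v))
  have G : ∀ x y u v,
      Q.ipG (κ'.curv x y) (κ'.curv u v) - Q.ipG (κ'.curv u v) (κ'.curv x y)
        - Q.ipG (κ.curv x y) (κ.curv u v) + Q.ipG (κ.curv u v) (κ.curv x y)
        + Q.ipG (Q.bracket (κ.diff κ' x) (κ.diff κ' y)) (Q.bracket (κ.diff κ' u) (κ.diff κ' v))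
        - Q.ipG (Q.bracket (κ.diff κ' u) (κ.diff κ' v)) (Q.bracket (κ.diff κ' x) (κ.diff κ' y))
      = 0 := fun x y u v => by
    linear_combination S (κ'.curv x y) (κ'.curv u v) - S (κ.curv x y) (κ.curv u v)
      + S (Q.bracket (κ.diff κ' x) (κ.diff κ' y)) (Q.bracket (κ.diff κ' u) (κ.diff κ' v))
  have N : ∀ x y u v, Q.ipG (Q.bracket (κ.diff κ' x) (κ.diff κ' y)) (κ'.curv u v)
      + Q.ipG (Q.bracket (κ.diff κ' y) (κ.diff κ' x)) (κ'.curv u v) = 0 := fun x y u v => by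
    rw [Q.bracket_skew (κ.diff κ' x), map_neg, LinearMap.neg_apply, neg_add_cancel]
  simp only [dCE3, pont4_eq, transgression, fact_add, fact_sub, map_add, act, act', actB]
  linear_combination (E x₁ x₂ x₃ x₄ + E x₃ x₄ x₁ x₂ + G x₁ x₂ x₃ x₄
      + N x₁ x₂ x₃ x₄ + N x₃ x₄ x₁ x₂)
    - (E x₁ x₃ x₂ x₄ + E x₂ x₄ x₁ x₃ + G x₁ x₃ x₂ x₄
      + N x₁ x₃ x₂ x₄ + N x₂ x₄ x₁ x₃)
    + (E x₁ x₄ x₂ x₃ + E x₂ x₃ x₁ x₄ + G x₁ x₄ x₂ x₃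
      + N x₁ x₄ x₂ x₃ + N x₂ x₃ x₁ x₄)
    + B κ x₂ x₃ x₄ x₁ - B κ x₁ x₃ x₄ x₂ + B κ x₁ x₂ x₄ x₃ - B κ x₁ x₂ x₃ x₄
    + B κ' x₂ x₃ x₄ x₁ - B κ' x₁ x₃ x₄ x₂ + B κ' x₁ x₂ x₄ x₃ - B κ' x₁ x₂ x₃ x₄ - 2 * K

end Hoist

end QuadLieAlgebroid

open QuadLieAlgebroid in
/-- `⟨R^κ∧R^κ⟩` is closed for the leafwise de Rham differential, and
for any two hoists `κ, κ'` the difference `⟨R^{κ'}∧R^{κ'}⟩ − ⟨R^κ∧R^κ⟩` is leafwise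
exact; hence the first Pontryagin class in `H⁴(F)` is well defined. -/
theorem statement6
    {A : Type} [CommRing A] [Algebra ℝ A]
    {L : Type} [AddCommGroup L] [Module A L] [Module ℝ L] [IsScalarTower ℝ A L]
    (Q : QuadLieAlgebroid A L) (κ : Q.Hoist) :
    -- ⟨R^κ∧R^κ⟩ is d^F-closed
    (∀ x₀ x₁ x₂ x₃ x₄ : ↥Q.Fq,
      dCE4 Q.fact Q.fbk (Q.pont4 κ) x₀ x₁ x₂ x₃ x₄ = 0) ∧
    -- its class in H⁴(F) does not depend on the choice of the hoist
    (∀ κ' : Q.Hoist, ∃ η : ↥Q.Fq → ↥Q.Fq → ↥Q.Fq → A,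
      -- η is a leafwise 3-form: alternating and C^∞(M)-multilinear
      (∀ (f : A) x x' y z, η (f • x + x') y z = f * η x y z + η x' y z) ∧
      (∀ x y z, η x y z = - η y x z) ∧
      (∀ x y z, η x y z = - η x z y) ∧
      -- ⟨R^{κ'}∧R^{κ'}⟩ − ⟨R^κ∧R^κ⟩ = d^F η
      (∀ x₁ x₂ x₃ x₄ : ↥Q.Fq,
        Q.pont4 κ' x₁ x₂ x₃ x₄ - Q.pont4 κ x₁ x₂ x₃ x₄
          = dCE3 Q.fact Q.fbk η x₁ x₂ x₃ x₄)) := by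
  exact ⟨dCE4_pont4 κ, fun κ' => ⟨κ.transgression κ', κ.transgression_smul_add_left κ',
    κ.transgression_swap_left κ', κ.transgression_swap_right κ', κ.pont4_sub_pont4 κ'⟩⟩
end
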